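/- arXiv:2602.17506 — 4 statements merged into one kernel-verified Lean document; each statement's English description precedes it below -/
import Mathlib

section
/- Let h > 0 and let (s,v,u,w) be a solution of the regularized blown-up system satisfying the energy relation with 0 < s(tau) < 1 for all tau, and suppose v(tau*) >= 0 for some tau* (no forward triple collision). Then as tau -> +infinity: s(tau) -> 1, w(tau) -> 0, u(tau) converges to some finite limit u_plus, and v(tau) converges to some limit v_plus >= sqrt(2*h); that is, the solution converges to an equilibrium point (1, v_plus, u_plus, 0) on the infinity manifold {s = 1}. Moreover, if cos(u_plus) is nonzero then v_plus = sqrt(2*h), and if v_plus > sqrt(2*h) then cos(u_plus) = 0 (so u_plus is congruent to plus or minus pi/2 modulo pi). -/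
open Real Filter Topology MeasureTheory

/-- The regularized shape potential `W(u)` of the isosceles three-body problem with
masses `m1 = m2 = 1`, `m3`, where `mu = 2*m3/(2+m3)`. -/
noncomputable def Wpot (m3 u : ℝ) : ℝ :=
  1 / Real.sqrt 2 +
    2 * m3 * Real.cos u ^ 2 /
      Real.sqrt (Real.cos u ^ 4 / 2 + (1 - Real.cos u ^ 4) / (2 * m3 / (2 + m3)))

/-- The energy function `E(s,v,u,w)` for energy `h`. -/
noncomputable def energyFn (m3 h s v u w : ℝ) : ℝ :=
  1 / 2 * (v ^ 2 * Real.cos u ^ 2 + w ^ 2) - (1 - s) * Wpot m3 u - h * s * Real.cos u ^ 2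

/-- `(s,v,u,w) : ℝ → ℝ` is a (globally defined) solution of the regularized blown-up
system of the isosceles three-body problem with mass `m3` and energy `h`. -/
def IsSolution (m3 h : ℝ) (s v u w : ℝ → ℝ) : Prop :=
  (∀ τ : ℝ, HasDerivAt s (v τ * s τ * (1 - s τ) * Real.cos (u τ) ^ 2) τ) ∧
  (∀ τ : ℝ, HasDerivAt v (1 / 2 * (1 - s τ) * v τ ^ 2 * Real.cos (u τ) ^ 2 + w τ ^ 2
      - (1 - s τ) * Wpot m3 (u τ)) τ) ∧
  (∀ τ : ℝ, HasDerivAt u (1 / 2 * Real.sqrt (1 + Real.cos (u τ) ^ 2) * w τ) τ) ∧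
  (∀ τ : ℝ, HasDerivAt w (-(1 / 2) * (1 + s τ) * v τ * w τ * Real.cos (u τ) ^ 2
      + 1 / 2 * Real.sqrt (1 + Real.cos (u τ) ^ 2) * (1 - s τ) * deriv (Wpot m3) (u τ)
      + 1 / 2 * (v τ ^ 2 - 2 * h * s τ) * Real.sqrt (1 + Real.cos (u τ) ^ 2)
          * Real.sin (u τ) * Real.cos (u τ)) τ)

/-- The solution satisfies the energy relation `E = 0` at all times. -/
def SatisfiesEnergy (m3 h : ℝ) (s v u w : ℝ → ℝ) : Prop :=
  ∀ τ : ℝ, energyFn m3 h (s τ) (v τ) (u τ) (w τ) = 0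

section Comparison

/-- A function whose derivative is dominated by `-g'` moves on `[a, b]` by at most the
decrease of `g`. -/
lemma abs_sub_le_of_abs_deriv_le {f g f' g' : ℝ → ℝ} {a b : ℝ} (hab : a ≤ b)
    (hf : ∀ t, HasDerivAt f (f' t) t) (hg : ∀ t, HasDerivAt g (g' t) t)
    (hfg : ∀ t, a < t → t < b → |f' t| ≤ -g' t) : |f b - f a| ≤ g a - g b := by
  have hanti : AntitoneOn (fun t => f t + g t) (Set.Icc a b) := by
    refine antitoneOn_of_deriv_nonpos (convex_Icc a b)
      (fun t _ => ((hf t).add (hg t)).continuousAt.continuousWithinAt)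
      (fun t _ => ((hf t).add (hg t)).differentiableAt.differentiableWithinAt) fun t ht => ?_
    rw [interior_Icc] at ht
    have h1 := abs_le.1 (hfg t ht.1 ht.2)
    have h2 : deriv (fun t => f t + g t) t = f' t + g' t := ((hf t).add (hg t)).deriv
    rw [h2]
    linarith [h1.2]
  have hmono : MonotoneOn (fun t => f t - g t) (Set.Icc a b) := by
    refine monotoneOn_of_deriv_nonneg (convex_Icc a b)
      (fun t _ => ((hf t).sub (hg t)).continuousAt.continuousWithinAt)
      (fun t _ => ((hf t).sub (hg t)).differentiableAt.differentiableWithinAt) fun t ht => ?_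
    rw [interior_Icc] at ht
    have h1 := abs_le.1 (hfg t ht.1 ht.2)
    have h2 : deriv (fun t => f t - g t) t = f' t - g' t := ((hf t).sub (hg t)).deriv
    rw [h2]
    linarith [h1.1]
  have h1 := hanti (Set.left_mem_Icc.2 hab) (Set.right_mem_Icc.2 hab) hab
  have h2 := hmono (Set.left_mem_Icc.2 hab) (Set.right_mem_Icc.2 hab) hab
  simp only at h1 h2
  rw [abs_le]
  constructor <;> linarith

/-- If `|f'| ≤ -g'` eventually and `g` tends to `0`, then `f` converges. -/
lemma exists_tendsto_of_abs_deriv_le {f g f' g' : ℝ → ℝ} {T : ℝ}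
    (hf : ∀ t, HasDerivAt f (f' t) t) (hg : ∀ t, HasDerivAt g (g' t) t)
    (hfg : ∀ t, T ≤ t → |f' t| ≤ -g' t) (hg0 : Tendsto g atTop (𝓝 0)) :
    ∃ l, Tendsto f atTop (𝓝 l) := by
  refine cauchySeq_tendsto_of_complete (Metric.cauchySeq_iff'.2 fun ε hε => ?_)
  have h1 : ∀ᶠ t in atTop, |g t| < ε / 2 := by
    have := hg0.abs
    rw [abs_zero] at this
    exact this.eventually_lt_const (half_pos hε)
  obtain ⟨N, hN⟩ := eventually_atTop.1 h1
  refine ⟨max N T, fun n hn => ?_⟩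
  have h2 := abs_sub_le_of_abs_deriv_le hn hf hg
    (fun t ht _ => hfg t ((le_max_right N T).trans ht.le))
  have h3 := abs_lt.1 (hN _ (le_max_left N T))
  have h4 := abs_lt.1 (hN n ((le_max_left N T).trans hn))
  rw [Real.dist_eq]
  linarith

/-- A monotone function bounded by `L` either tends to `L` or stays below some `b < L`. -/
lemma tendsto_or_exists_lt_of_monotoneOn {f : ℝ → ℝ} {T L : ℝ}
    (hf : MonotoneOn f (Set.Ici T)) (hL : ∀ t, T ≤ t → f t ≤ L) :
    Tendsto f atTop (𝓝 L) ∨ ∃ b < L, ∀ t, T ≤ t → f t ≤ b := by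
  by_contra! hcon
  refine hcon.1 (tendsto_order.2 ⟨fun b hb => ?_, fun b hb => ?_⟩)
  · obtain ⟨t₀, ht₀, hbt⟩ := hcon.2 b hb
    filter_upwards [eventually_ge_atTop t₀] with t ht
    exact hbt.trans_le (hf ht₀ (Set.mem_Ici.2 (ht₀.trans ht)) ht)
  · filter_upwards [eventually_ge_atTop T] with t ht
    exact (hL t ht).trans_lt hb

lemma tendsto_zero_of_tendsto_sq_zero {f : ℝ → ℝ}
    (hf : Tendsto (fun t => f t ^ 2) atTop (𝓝 0)) : Tendsto f atTop (𝓝 0) := by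
  rw [tendsto_zero_iff_abs_tendsto_zero]
  have := hf.sqrt
  simpa only [Real.sqrt_sq_eq_abs, Real.sqrt_zero, Function.comp_def] using this

/-- The differential inequality `-g f ≤ f'` preserves non-negativity. -/
lemma nonneg_of_neg_mul_le_deriv {f f' g : ℝ → ℝ} {T : ℝ} (hf : ∀ t, HasDerivAt f (f' t) t)
    (hg : Continuous g) (hfg : ∀ t, T ≤ t → -(g t * f t) ≤ f' t) (hT : 0 ≤ f T) {t : ℝ}
    (ht : T ≤ t) : 0 ≤ f t := by
  have hG : ∀ t, HasDerivAt (fun t => ∫ x in T..t, g x) (g t) t := fun t =>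
    intervalIntegral.integral_hasDerivAt_right (hg.intervalIntegrable _ _)
      (hg.stronglyMeasurableAtFilter _ _) hg.continuousAt
  have hF := fun t => (hf t).mul (hG t).exp
  have hmono : MonotoneOn (f * fun t => Real.exp (∫ x in T..t, g x)) (Set.Ici T) := by
    refine monotoneOn_of_deriv_nonneg (convex_Ici T)
      (fun t _ => (hF t).continuousAt.continuousWithinAt)
      (fun t _ => (hF t).differentiableAt.differentiableWithinAt) fun t ht => ?_
    rw [interior_Ici] at ht
    rw [(hF t).deriv]
    have h1 := hfg t (le_of_lt ht)
    have h2 := Real.exp_pos (∫ x in T..t, g x)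
    have h3 : 0 ≤ (f' t + g t * f t) * Real.exp (∫ x in T..t, g x) :=
      mul_nonneg (by linarith) h2.le
    linarith
  have h1 := hmono Set.self_mem_Ici (Set.mem_Ici.2 ht) ht
  simp only [Pi.mul_apply, intervalIntegral.integral_same, Real.exp_zero, mul_one] at h1
  exact nonneg_of_mul_nonneg_left (hT.trans h1) (Real.exp_pos _)

/-- A continuous angle whose cosine tends to `0` converges. -/
lemma exists_tendsto_of_tendsto_cos {u : ℝ → ℝ} (hu : Continuous u)
    (hcos : Tendsto (fun t => Real.cos (u t)) atTop (𝓝 0)) : ∃ l, Tendsto u atTop (𝓝 l) := by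
  have h1 : ∀ᶠ t in atTop, |Real.cos (u t)| < 1 := by
    have := hcos.abs
    rw [abs_zero] at this
    exact this.eventually_lt_const one_pos
  obtain ⟨T, hT⟩ := eventually_atTop.1 h1
  set k : ℤ := ⌊u T / π⌋ with hk
  have hne : ∀ t, T ≤ t → ∀ n : ℤ, u t ≠ n * π := fun t ht n hn => by
    have h2 := hT t ht
    rw [hn, Real.abs_cos_int_mul_pi] at h2
    exact lt_irrefl _ h2
  have hlow : (k : ℝ) * π < u T := by
    refine lt_of_le_of_ne ?_ (hne T le_rfl k).symm
    rw [← le_div_iff₀ Real.pi_pos]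
    exact Int.floor_le _
  have hupp : u T < ((k + 1 : ℤ) : ℝ) * π := by
    rw [← div_lt_iff₀ Real.pi_pos]
    push_cast
    exact Int.lt_floor_add_one _
  have hstay : ∀ t, T ≤ t → (k : ℝ) * π < u t ∧ u t < ((k + 1 : ℤ) : ℝ) * π := by
    intro t ht
    constructor
    · by_contra! hcon
      obtain ⟨r, hr, hrk⟩ := intermediate_value_Icc' ht hu.continuousOn ⟨hcon, hlow.le⟩
      exact hne r hr.1 k hrk
    · by_contra! hcon
      obtain ⟨r, hr, hrk⟩ := intermediate_value_Icc ht hu.continuousOn ⟨hupp.le, hcon⟩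
      exact hne r hr.1 _ hrk
  refine ⟨Real.arccos ((-1) ^ k * 0) + k * π, ?_⟩
  have h3 : Tendsto (fun t => Real.arccos ((-1) ^ k * Real.cos (u t)) + k * π) atTop
      (𝓝 (Real.arccos ((-1) ^ k * 0) + k * π)) :=
    ((Real.continuous_arccos.tendsto _).comp (hcos.const_mul _)).add_const _
  refine h3.congr' ?_
  filter_upwards [eventually_ge_atTop T] with t ht
  obtain ⟨h4, h5⟩ := hstay t ht
  push_cast at h5
  rw [← Real.cos_sub_int_mul_pi, Real.arccos_cos (by linarith) (by linarith)]
  ring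

end Comparison

section Potential

lemma shape_denominator_eq {m3 : ℝ} (hm3 : 0 < m3) (c : ℝ) :
    c ^ 4 / 2 + (1 - c ^ 4) / (2 * m3 / (2 + m3)) = 1 / 2 + (1 - c ^ 4) / m3 := by
  field_simp
  ring

/-- Two-sided bounds for the shape potential, and a bound for its derivative near the
binary collisions `cos u = 0`. -/
lemma Wpot_bounds {m3 : ℝ} (hm3 : 0 < m3) :
    ∃ M : ℝ, ∀ u, 1 / 2 ≤ Wpot m3 u ∧ Wpot m3 u ≤ M ∧
      |deriv (Wpot m3) u| ≤ M * |Real.cos u| := by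
  refine ⟨8 * m3 + 33, fun u => ?_⟩
  have hW : Wpot m3 = fun u => 1 / Real.sqrt 2 +
      2 * m3 * Real.cos u ^ 2 / Real.sqrt (1 / 2 + (1 - Real.cos u ^ 4) / m3) := by
    funext u
    rw [Wpot, shape_denominator_eq hm3]
  have hsq2 : Real.sqrt 2 ≤ 2 := by
    rw [Real.sqrt_le_left (by norm_num)]
    norm_num
  have hsq2' : 1 ≤ Real.sqrt 2 := Real.one_le_sqrt.2 (by norm_num)
  have hinv2 : 1 / 2 ≤ 1 / Real.sqrt 2 := one_div_le_one_div_of_le (by linarith) hsq2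
  have hinv2' : 1 / Real.sqrt 2 ≤ 1 := by
    rw [div_le_one (by linarith)]
    exact hsq2'
  have hc2 : Real.cos u ^ 2 ≤ 1 := Real.cos_sq_le_one u
  have hc4 : Real.cos u ^ 4 ≤ 1 := by nlinarith [sq_nonneg (Real.cos u)]
  have hDge : 1 / 2 ≤ 1 / 2 + (1 - Real.cos u ^ 4) / m3 := by
    have : 0 ≤ (1 - Real.cos u ^ 4) / m3 := div_nonneg (by linarith) hm3.le
    linarith
  have hDpos : 0 < 1 / 2 + (1 - Real.cos u ^ 4) / m3 := by linarith
  set r := Real.sqrt (1 / 2 + (1 - Real.cos u ^ 4) / m3) with hr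
  have hrr : 1 / 2 ≤ r := Real.le_sqrt_of_sq_le (by linarith)
  have hr0 : 0 < r := by linarith
  have hrinv : 1 / r ≤ 2 := by
    rw [div_le_iff₀ hr0]
    linarith
  have hrinv0 : 0 < 1 / r := by positivity
  have hterm : 0 ≤ 2 * m3 * Real.cos u ^ 2 / r := by positivity
  have hterm' : 2 * m3 * Real.cos u ^ 2 / r ≤ 4 * m3 := by
    rw [div_le_iff₀ hr0]
    nlinarith
  have hval : Wpot m3 u = 1 / Real.sqrt 2 + 2 * m3 * Real.cos u ^ 2 / r := congrFun hW u
  refine ⟨by linarith, by linarith, ?_⟩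
  have hcos := Real.hasDerivAt_cos u
  have hD : HasDerivAt (fun u => 1 / 2 + (1 - Real.cos u ^ 4) / m3)
      (4 * Real.cos u ^ 3 * Real.sin u / m3) u := by
    refine ((((hcos.fun_pow 4).const_sub 1).div_const m3).const_add (1 / 2)).congr_deriv ?_
    push_cast
    ring
  have hder : HasDerivAt (Wpot m3) (Real.cos u * (2 * m3 * (-2 * Real.sin u * (1 / r)) -
      4 * Real.cos u ^ 4 * Real.sin u * (1 / r) ^ 3)) u := by
    rw [hW]
    refine ((((hcos.fun_pow 2).const_mul (2 * m3)).fun_div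
      (hD.sqrt hDpos.ne') hr0.ne').const_add (1 / Real.sqrt 2)).congr_deriv ?_
    rw [← hr]
    field_simp
    ring
  rw [hder.deriv, abs_mul, mul_comm]
  refine mul_le_mul_of_nonneg_right ?_ (abs_nonneg _)
  have hS : |Real.sin u| ≤ 1 := Real.abs_sin_le_one u
  have h1 : |2 * m3 * (-2 * Real.sin u * (1 / r))| ≤ 8 * m3 := by
    rw [show 2 * m3 * (-2 * Real.sin u * (1 / r)) = -(4 * m3 * (Real.sin u * (1 / r))) by ring,
      abs_neg, abs_mul (4 * m3), abs_mul (Real.sin u), abs_of_pos hrinv0,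
      abs_of_pos (by positivity : 0 < 4 * m3)]
    have : |Real.sin u| * (1 / r) ≤ 1 * 2 := mul_le_mul hS hrinv hrinv0.le one_pos.le
    nlinarith
  have h2 : |4 * Real.cos u ^ 4 * Real.sin u * (1 / r) ^ 3| ≤ 32 := by
    have h3 : (1 / r) ^ 3 ≤ 2 ^ 3 := pow_le_pow_left₀ hrinv0.le hrinv 3
    rw [abs_mul, abs_mul, abs_of_nonneg (by positivity : 0 ≤ 4 * Real.cos u ^ 4),
      abs_of_pos (pow_pos hrinv0 3)]
    have h4 : 4 * Real.cos u ^ 4 * |Real.sin u| ≤ 4 * 1 :=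
      mul_le_mul (by linarith) hS (abs_nonneg _) (by norm_num)
    calc _ ≤ 4 * 1 * (2 : ℝ) ^ 3 := mul_le_mul h4 h3 (pow_pos hrinv0 3).le (by norm_num)
      _ = 32 := by norm_num
  refine (abs_sub _ _).trans ?_
  linarith

end Potential

section Orbit

variable {m3 h : ℝ} {s v u w : ℝ → ℝ}

lemma SatisfiesEnergy.sq_add_eq (hE : SatisfiesEnergy m3 h s v u w) (t : ℝ) :
    w t ^ 2 + Real.cos (u t) ^ 2 * (v t ^ 2 - 2 * h * s t) =
      2 * (1 - s t) * Wpot m3 (u t) := by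
  have := hE t
  rw [energyFn] at this
  linear_combination 2 * this

/-- On the zero energy level the shape potential can be eliminated from `v'`. -/
lemma IsSolution.hasDerivAt_v (hsol : IsSolution m3 h s v u w)
    (hE : SatisfiesEnergy m3 h s v u w) (t : ℝ) :
    HasDerivAt v (1 / 2 * w t ^ 2 + 1 / 2 * s t * Real.cos (u t) ^ 2 * (2 * h - v t ^ 2)) t := by
  refine (hsol.2.1 t).congr_deriv ?_
  linear_combination (1 / 2) * hE.sq_add_eq t

lemma IsSolution.continuous (hsol : IsSolution m3 h s v u w) :
    Continuous s ∧ Continuous v ∧ Continuous u ∧ Continuous w :=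
  ⟨continuous_iff_continuousAt.2 fun t => (hsol.1 t).continuousAt,
    continuous_iff_continuousAt.2 fun t => (hsol.2.1 t).continuousAt,
    continuous_iff_continuousAt.2 fun t => (hsol.2.2.1 t).continuousAt,
    continuous_iff_continuousAt.2 fun t => (hsol.2.2.2 t).continuousAt⟩

/-- The half spaces `{v ≥ a}` with `0 ≤ a ≤ √(2h)` are forward invariant. -/
lemma IsSolution.le_v_of_le (hsol : IsSolution m3 h s v u w)
    (hE : SatisfiesEnergy m3 h s v u w) (hs : ∀ t, 0 < s t) {a T : ℝ} (ha : a ^ 2 ≤ 2 * h)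
    (hT : a ≤ v T) {t : ℝ} (ht : T ≤ t) : a ≤ v t := by
  obtain ⟨hsc, hvc, huc, hwc⟩ := hsol.continuous
  have h1 : 0 ≤ v t - a := by
    refine nonneg_of_neg_mul_le_deriv (f := fun t => v t - a)
      (g := fun t => 1 / 2 * s t * Real.cos (u t) ^ 2 * (v t + a))
      (fun t => (hsol.hasDerivAt_v hE t).sub_const a) (by fun_prop) (fun t _ => ?_)
      (sub_nonneg.2 hT) ht
    have h2 : 0 ≤ 1 / 2 * s t * Real.cos (u t) ^ 2 * (2 * h - a ^ 2) :=
      mul_nonneg (mul_nonneg (mul_nonneg (by norm_num) (hs t).le) (sq_nonneg _)) (by linarith)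
    nlinarith [sq_nonneg (w t)]
  linarith

/-- Data of a forward-time tail on which `v` and `s` are bounded below by positive constants. -/
structure IsEscapeTail (m3 h M v₀ s₀ T : ℝ) (s v u w : ℝ → ℝ) : Prop where
  sol : IsSolution m3 h s v u w
  energy : SatisfiesEnergy m3 h s v u w
  s_mem : ∀ t, 0 < s t ∧ s t < 1
  h_pos : 0 < h
  potential : ∀ u, 1 / 2 ≤ Wpot m3 u ∧ Wpot m3 u ≤ M ∧ |deriv (Wpot m3) u| ≤ M * |Real.cos u|
  v₀_pos : 0 < v₀
  s₀_pos : 0 < s₀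
  v_ge : ∀ t, T ≤ t → v₀ ≤ v t
  s_ge : ∀ t, T ≤ t → s₀ ≤ s t
  s_mono : MonotoneOn s (Set.Ici T)

lemma exists_isEscapeTail (hm3 : 0 < m3) (hh : 0 < h) (hsol : IsSolution m3 h s v u w)
    (hE : SatisfiesEnergy m3 h s v u w) (hs : ∀ τ : ℝ, 0 < s τ ∧ s τ < 1)
    (hv : ∃ τs : ℝ, 0 ≤ v τs) :
    ∃ M v₀ s₀ T, IsEscapeTail m3 h M v₀ s₀ T s v u w := by
  obtain ⟨M, hM⟩ := Wpot_bounds hm3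
  obtain ⟨τs, hτs⟩ := hv
  have hnn : ∀ t, τs ≤ t → 0 ≤ v t := fun t ht =>
    hsol.le_v_of_le hE (fun t => (hs t).1) (by linarith) hτs ht
  have hpos : 0 < v (τs + 1) := by
    refine lt_of_le_of_ne (hnn _ (by linarith)) fun h0 => ?_
    have hmin : IsLocalMin v (τs + 1) := by
      filter_upwards [lt_mem_nhds (lt_add_one τs)] with t ht
      rw [← h0]
      exact hnn t ht.le
    have h1 := hmin.hasDerivAt_eq_zero (hsol.hasDerivAt_v hE _)
    have h2 := hE.sq_add_eq (τs + 1)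
    have h3 : 0 < (1 - s (τs + 1)) * Wpot m3 (u (τs + 1)) :=
      mul_pos (sub_pos.2 (hs _).2) (by linarith [(hM (u (τs + 1))).1])
    rw [← h0] at h1 h2
    nlinarith [mul_nonneg (mul_nonneg hh.le (hs (τs + 1)).1.le)
      (sq_nonneg (Real.cos (u (τs + 1))))]
  have hv₀ : 0 < min (v (τs + 1)) (Real.sqrt (2 * h)) :=
    lt_min hpos (Real.sqrt_pos.2 (by linarith))
  have hvge : ∀ t, τs + 1 ≤ t → min (v (τs + 1)) (Real.sqrt (2 * h)) ≤ v t := fun t ht => by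
    refine hsol.le_v_of_le hE (fun t => (hs t).1) ?_ (min_le_left _ _) ht
    calc _ ≤ Real.sqrt (2 * h) ^ 2 := pow_le_pow_left₀ hv₀.le (min_le_right _ _) 2
      _ = 2 * h := Real.sq_sqrt (by linarith)
  have hmono : MonotoneOn s (Set.Ici (τs + 1)) := by
    refine monotoneOn_of_deriv_nonneg (convex_Ici _) hsol.continuous.1.continuousOn
      (fun t _ => (hsol.1 t).differentiableAt.differentiableWithinAt) fun t ht => ?_
    rw [interior_Ici] at ht
    rw [(hsol.1 t).deriv]
    exact mul_nonneg (mul_nonneg (mul_nonneg (hv₀.le.trans (hvge t (le_of_lt ht))) (hs t).1.le)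
      (sub_nonneg.2 (hs t).2.le)) (sq_nonneg _)
  exact ⟨M, _, s (τs + 1), τs + 1, hsol, hE, hs, hh, hM, hv₀, (hs _).1, hvge,
    fun t ht => hmono Set.self_mem_Ici ht ht, hmono⟩

/-- The factor of `cos u ^ 2` in the derivative of the corrected radial velocity. -/
lemma abs_virial_remainder_le {c S q w v x A D M : ℝ} (hSc : S ^ 2 + c ^ 2 = 1)
    (hq : q ^ 2 = 1 + c ^ 2) (hq0 : 0 ≤ q) (hx : 0 ≤ x) (hD : |D| ≤ M * |c|) :
    |1 / 2 * w ^ 2 * (1 - q + 2 * q * c ^ 2) - 1 / 2 * A * (1 - q * S ^ 2) - S * c ^ 3 * v * w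
        + 1 / 2 * q * S * c * x * D| ≤
      c ^ 2 * (2 * w ^ 2 + |A| + |c * v * w| + M * x) := by
  have hc2 : c ^ 2 ≤ 1 := by nlinarith [sq_nonneg S]
  have hq1 : 1 ≤ q := by nlinarith [sq_nonneg c]
  have hq2 : q ≤ 2 := by nlinarith
  have hS1 : |S| ≤ 1 := abs_le_one_iff_mul_self_le_one.2 (by nlinarith [sq_nonneg c])
  have hqc : 0 ≤ (q - 1) * c ^ 2 := mul_nonneg (by linarith) (sq_nonneg c)
  have hqc' : 0 ≤ (2 - q) * c ^ 2 := mul_nonneg (by linarith) (sq_nonneg c)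
  have hqm : q - 1 ≤ c ^ 2 := by nlinarith
  have h1 : |1 / 2 * w ^ 2 * (1 - q + 2 * q * c ^ 2)| ≤ 2 * w ^ 2 * c ^ 2 := by
    have h : |1 - q + 2 * q * c ^ 2| ≤ 4 * c ^ 2 := by
      rw [abs_le]
      constructor <;> nlinarith [sq_nonneg c]
    rw [abs_mul, abs_of_nonneg (by positivity : 0 ≤ 1 / 2 * w ^ 2)]
    nlinarith [sq_nonneg w]
  have h2 : |1 / 2 * A * (1 - q * S ^ 2)| ≤ |A| * c ^ 2 := by
    have h : |1 - q * S ^ 2| ≤ 2 * c ^ 2 := by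
      have : S ^ 2 = 1 - c ^ 2 := by linarith
      rw [this, abs_le]
      constructor <;> nlinarith [sq_nonneg c]
    rw [abs_mul, abs_mul, abs_of_pos (by norm_num : (0 : ℝ) < 1 / 2)]
    nlinarith [abs_nonneg A]
  have h3 : |S * c ^ 3 * v * w| ≤ c ^ 2 * |c * v * w| := by
    rw [show S * c ^ 3 * v * w = S * (c ^ 2 * (c * v * w)) by ring, abs_mul, abs_mul,
      abs_of_nonneg (sq_nonneg c)]
    exact mul_le_of_le_one_left (by positivity) hS1
  have h4 : |1 / 2 * q * S * c * x * D| ≤ c ^ 2 * (M * x) := by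
    rw [show 1 / 2 * q * S * c * x * D = (1 / 2 * q) * S * (c * (x * D)) by ring, abs_mul,
      abs_mul, abs_mul c, abs_mul x, abs_of_nonneg hx, abs_of_nonneg (by linarith : 0 ≤ 1 / 2 * q)]
    have h5 : 1 / 2 * q * |S| ≤ 1 * 1 := mul_le_mul (by linarith) hS1 (abs_nonneg _) one_pos.le
    have h6 : |c| * (x * |D|) ≤ c ^ 2 * (M * x) := by
      rw [← sq_abs c]
      nlinarith [mul_le_mul_of_nonneg_left hD (mul_nonneg (abs_nonneg c) hx)]
    have h7 : 0 ≤ |c| * (x * |D|) := by positivity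
    calc _ ≤ 1 * 1 * (|c| * (x * |D|)) := mul_le_mul_of_nonneg_right h5 h7
      _ ≤ _ := by linarith
  rw [abs_le] at h1 h2 h3 h4 ⊢
  constructor <;> linarith [h1.1, h1.2, h2.1, h2.2, h3.1, h3.2, h4.1, h4.2]

lemma IsSolution.hasDerivAt_sin_mul_cos_mul (hsol : IsSolution m3 h s v u w) (t : ℝ) :
    HasDerivAt (fun t => Real.sin (u t) * Real.cos (u t) * w t)
      (1 / 2 * Real.sqrt (1 + Real.cos (u t) ^ 2) * (2 * Real.cos (u t) ^ 2 - 1) * w t ^ 2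
        + 1 / 2 * Real.sqrt (1 + Real.cos (u t) ^ 2) * Real.sin (u t) ^ 2 *
          (Real.cos (u t) ^ 2 * (v t ^ 2 - 2 * h * s t))
        - 1 / 2 * (1 + s t) * Real.sin (u t) * Real.cos (u t) ^ 3 * v t * w t
        + 1 / 2 * Real.sqrt (1 + Real.cos (u t) ^ 2) * Real.sin (u t) * Real.cos (u t) *
          (1 - s t) * deriv (Wpot m3) (u t)) t := by
  refine (((hsol.2.2.1 t).sin.mul (hsol.2.2.1 t).cos).mul (hsol.2.2.2 t)).congr_deriv ?_
  simp only [Pi.mul_apply]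
  linear_combination -(1 / 2 * Real.sqrt (1 + Real.cos (u t) ^ 2) * w t ^ 2) *
    Real.sin_sq_add_cos_sq (u t)

/-- The corrected radial velocity `(v + sin u cos u w) / √s`. -/
lemma IsSolution.hasDerivAt_corrected (hsol : IsSolution m3 h s v u w)
    (hE : SatisfiesEnergy m3 h s v u w) (hs : ∀ t, 0 < s t) (t : ℝ) :
    HasDerivAt (fun t => (v t + Real.sin (u t) * Real.cos (u t) * w t) / Real.sqrt (s t))
      ((1 / 2 * w t ^ 2 * (1 - Real.sqrt (1 + Real.cos (u t) ^ 2)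
            + 2 * Real.sqrt (1 + Real.cos (u t) ^ 2) * Real.cos (u t) ^ 2)
        - 1 / 2 * (Real.cos (u t) ^ 2 * (v t ^ 2 - 2 * h * s t)) *
          (1 - Real.sqrt (1 + Real.cos (u t) ^ 2) * Real.sin (u t) ^ 2)
        - Real.sin (u t) * Real.cos (u t) ^ 3 * v t * w t
        + 1 / 2 * Real.sqrt (1 + Real.cos (u t) ^ 2) * Real.sin (u t) * Real.cos (u t) *
          (1 - s t) * deriv (Wpot m3) (u t)) / Real.sqrt (s t)) t := by
  have hr : 0 < Real.sqrt (s t) := Real.sqrt_pos.2 (hs t)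
  have hrs : Real.sqrt (s t) ^ 2 = s t := Real.sq_sqrt (hs t).le
  have hroot : HasDerivAt (fun t => Real.sqrt (s t))
      (1 / 2 * v t * (1 - s t) * Real.cos (u t) ^ 2 * Real.sqrt (s t)) t := by
    refine ((hsol.1 t).sqrt (hs t).ne').congr_deriv ?_
    rw [div_eq_iff (by positivity)]
    linear_combination -(v t * (1 - s t) * Real.cos (u t) ^ 2) * hrs
  refine (((hsol.2.1 t).add (hsol.hasDerivAt_sin_mul_cos_mul t)).fun_div hroot
    hr.ne').congr_deriv ?_
  rw [div_eq_div_iff (by positivity) hr.ne']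
  simp only [Pi.add_apply]
  linear_combination (1 / 2 * Real.sqrt (s t) ^ 2) * hE.sq_add_eq t

lemma virial_le {c S q w v s x A D M : ℝ} (hSc : S ^ 2 + c ^ 2 = 1)
    (hq : q ^ 2 = 1 + c ^ 2) (hq0 : 0 ≤ q) (hs0 : 0 ≤ s) (hs1 : s ≤ 1) (hx : 0 ≤ x)
    (hD : |D| ≤ M * |c|) :
    1 / 2 * q * (2 * c ^ 2 - 1) * w ^ 2 + 1 / 2 * q * S ^ 2 * A
        - 1 / 2 * (1 + s) * S * c ^ 3 * v * w + 1 / 2 * q * S * c * x * D ≤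
      -(1 / 2) * w ^ 2 + |A| + c ^ 2 * (2 * w ^ 2 + |c * v * w| + M * x) := by
  have hc2 : c ^ 2 ≤ 1 := by nlinarith [sq_nonneg S]
  have hq1 : 1 ≤ q := by nlinarith [sq_nonneg c]
  have hq2 : q ≤ 2 := by nlinarith
  have hS1 : |S| ≤ 1 := abs_le_one_iff_mul_self_le_one.2 (by nlinarith [sq_nonneg c])
  have h1 : 1 / 2 * q * (2 * c ^ 2 - 1) * w ^ 2 ≤ -(1 / 2) * w ^ 2 + 2 * c ^ 2 * w ^ 2 := by
    have h : 0 ≤ (2 - q) * c ^ 2 := mul_nonneg (by linarith) (sq_nonneg c)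
    nlinarith [sq_nonneg w]
  have h2 : 1 / 2 * q * S ^ 2 * A ≤ |A| := by
    refine (le_abs_self _).trans ?_
    rw [abs_mul, abs_of_nonneg (by positivity : 0 ≤ 1 / 2 * q * S ^ 2)]
    refine mul_le_of_le_one_left (abs_nonneg _) ?_
    calc 1 / 2 * q * S ^ 2 ≤ 1 * 1 :=
          mul_le_mul (by linarith) (by nlinarith [sq_nonneg c]) (sq_nonneg _) one_pos.le
      _ = 1 := one_mul 1
  have h3 : -(1 / 2 * (1 + s) * S * c ^ 3 * v * w) ≤ c ^ 2 * |c * v * w| := by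
    refine (neg_le_abs _).trans ?_
    rw [show 1 / 2 * (1 + s) * S * c ^ 3 * v * w =
        (1 / 2 * (1 + s)) * S * (c ^ 2 * (c * v * w)) by ring, abs_mul, abs_mul, abs_mul (c ^ 2),
      abs_of_nonneg (sq_nonneg c), abs_of_nonneg (by linarith : 0 ≤ 1 / 2 * (1 + s))]
    refine mul_le_of_le_one_left (by positivity) ?_
    calc 1 / 2 * (1 + s) * |S| ≤ 1 * 1 := mul_le_mul (by linarith) hS1 (abs_nonneg _) one_pos.le
      _ = 1 := one_mul 1
  have h4 : 1 / 2 * q * S * c * x * D ≤ c ^ 2 * (M * x) := by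
    refine (le_abs_self _).trans ?_
    rw [show 1 / 2 * q * S * c * x * D = (1 / 2 * q) * S * (c * (x * D)) by ring, abs_mul,
      abs_mul, abs_mul c, abs_mul x, abs_of_nonneg hx, abs_of_nonneg (by linarith : 0 ≤ 1 / 2 * q)]
    have h5 : 1 / 2 * q * |S| ≤ 1 * 1 := mul_le_mul (by linarith) hS1 (abs_nonneg _) one_pos.le
    have h6 : |c| * (x * |D|) ≤ c ^ 2 * (M * x) := by
      rw [← sq_abs c]
      nlinarith [mul_le_mul_of_nonneg_left hD (mul_nonneg (abs_nonneg c) hx)]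
    have h7 : 0 ≤ |c| * (x * |D|) := by positivity
    calc _ ≤ 1 * 1 * (|c| * (x * |D|)) := mul_le_mul_of_nonneg_right h5 h7
      _ ≤ _ := by linarith
  linarith

namespace IsEscapeTail

variable {M v₀ s₀ T : ℝ}

lemma M_pos (H : IsEscapeTail m3 h M v₀ s₀ T s v u w) : 0 < M := by
  have := H.potential 0
  linarith [this.1, this.2.1]

lemma potential_term_nonneg (H : IsEscapeTail m3 h M v₀ s₀ T s v u w) (t : ℝ) :
    0 ≤ (1 - s t) * Wpot m3 (u t) :=
  mul_nonneg (sub_nonneg.2 (H.s_mem t).2.le) (by linarith [(H.potential (u t)).1])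

lemma potential_term_le (H : IsEscapeTail m3 h M v₀ s₀ T s v u w) (t : ℝ) :
    (1 - s t) * Wpot m3 (u t) ≤ M * (1 - s t) := by
  rw [mul_comm M]
  exact mul_le_mul_of_nonneg_left (H.potential (u t)).2.1 (sub_nonneg.2 (H.s_mem t).2.le)

lemma kinetic_le (H : IsEscapeTail m3 h M v₀ s₀ T s v u w) (t : ℝ) :
    w t ^ 2 + (Real.cos (u t) * v t) ^ 2 ≤ 2 * M + 2 * h := by
  have h1 := H.energy.sq_add_eq t
  have h2 := H.potential_term_le t
  have h3 : M * (1 - s t) ≤ M * 1 :=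
    mul_le_mul_of_nonneg_left (by linarith [(H.s_mem t).1]) H.M_pos.le
  have h4 : s t * Real.cos (u t) ^ 2 ≤ 1 * 1 :=
    mul_le_mul (H.s_mem t).2.le (Real.cos_sq_le_one _) (sq_nonneg _) one_pos.le
  nlinarith [H.h_pos]

lemma abs_mul_mul_le (H : IsEscapeTail m3 h M v₀ s₀ T s v u w) (t : ℝ) :
    |Real.cos (u t) * v t * w t| ≤ 2 * M + 2 * h := by
  have h1 := H.kinetic_le t
  rw [abs_le]
  constructor
  · nlinarith [sq_nonneg (Real.cos (u t) * v t + w t), sq_nonneg (Real.cos (u t) * v t - w t)]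
  · nlinarith [sq_nonneg (Real.cos (u t) * v t + w t), sq_nonneg (Real.cos (u t) * v t - w t)]

lemma abs_virial_function_le (H : IsEscapeTail m3 h M v₀ s₀ T s v u w) (t : ℝ) :
    |Real.sin (u t) * Real.cos (u t) * w t| ≤ 1 + (2 * M + 2 * h) := by
  have h1 := H.kinetic_le t
  have h2 : |Real.sin (u t)| * |Real.cos (u t)| ≤ 1 * 1 :=
    mul_le_mul (Real.abs_sin_le_one _) (Real.abs_cos_le_one _) (abs_nonneg _) one_pos.le
  rw [abs_mul, abs_mul]
  have h3 : |Real.sin (u t)| * |Real.cos (u t)| * |w t| ≤ |w t| :=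
    mul_le_of_le_one_left (abs_nonneg _) (by linarith)
  nlinarith [sq_abs (w t), sq_nonneg (|w t| - 1), sq_nonneg (Real.cos (u t) * v t)]

lemma sqrt_one_add_cos_sq (x : ℝ) :
    Real.sqrt (1 + Real.cos x ^ 2) ^ 2 = 1 + Real.cos x ^ 2 :=
  Real.sq_sqrt (by positivity)

lemma cos_sq_le (H : IsEscapeTail m3 h M v₀ s₀ T s v u w) {t : ℝ} (ht : T ≤ t) :
    Real.cos (u t) ^ 2 ≤ 1 / (v₀ * s₀) * (v t * s t * Real.cos (u t) ^ 2) := by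
  have h1 : v₀ * s₀ ≤ v t * s t :=
    mul_le_mul (H.v_ge t ht) (H.s_ge t ht) H.s₀_pos.le (H.v₀_pos.le.trans (H.v_ge t ht))
  have h2 : 0 < v₀ * s₀ := mul_pos H.v₀_pos H.s₀_pos
  rw [one_div, inv_mul_eq_div, le_div_iff₀ h2, mul_comm]
  exact mul_le_mul_of_nonneg_right h1 (sq_nonneg _)

lemma cos_sq_le_mul_deriv (H : IsEscapeTail m3 h M v₀ s₀ T s v u w) {b t : ℝ} (hb : b < 1)
    (ht : T ≤ t) (hsb : s t ≤ b) : Real.cos (u t) ^ 2 ≤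
      1 / (v₀ * s₀) * (1 / (1 - b)) * (v t * s t * (1 - s t) * Real.cos (u t) ^ 2) := by
  have hvs : 0 < v₀ * s₀ := mul_pos H.v₀_pos H.s₀_pos
  have h1 : 0 ≤ v t * s t * Real.cos (u t) ^ 2 :=
    mul_nonneg (mul_nonneg (H.v₀_pos.le.trans (H.v_ge t ht)) (H.s_mem t).1.le) (sq_nonneg _)
  have h2 : 1 ≤ 1 / (1 - b) * (1 - s t) := by
    rw [one_div, inv_mul_eq_div, le_div_iff₀ (sub_pos.2 hb)]
    linarith
  calc _ ≤ 1 / (v₀ * s₀) * (v t * s t * Real.cos (u t) ^ 2) := H.cos_sq_le ht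
    _ ≤ 1 / (v₀ * s₀) * (v t * s t * Real.cos (u t) ^ 2) * (1 / (1 - b) * (1 - s t)) :=
        le_mul_of_one_le_right (by positivity) h2
    _ = _ := by ring

lemma inv_sqrt_le (H : IsEscapeTail m3 h M v₀ s₀ T s v u w) {t : ℝ} (ht : T ≤ t) :
    1 / Real.sqrt (s t) ≤ 1 / Real.sqrt s₀ :=
  one_div_le_one_div_of_le (Real.sqrt_pos.2 H.s₀_pos) (Real.sqrt_le_sqrt (H.s_ge t ht))

/-- If `s` stayed away from `1`, the corrected radial velocity, hence `v`, would be bounded. -/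
lemma exists_abs_v_le (H : IsEscapeTail m3 h M v₀ s₀ T s v u w) {b : ℝ} (hb : b < 1)
    (hsb : ∀ t, T ≤ t → s t ≤ b) : ∃ V, ∀ t, T ≤ t → |v t| ≤ V := by
  have hM := H.M_pos
  have hh := H.h_pos
  have hvs : 0 < v₀ * s₀ := mul_pos H.v₀_pos H.s₀_pos
  set C := 2 * M + 2 * h with hC
  set K := (2 * C + (C + 2 * h) + C + M) * (1 / (v₀ * s₀) * (1 / (1 - b))) * (1 / Real.sqrt s₀)
    with hK
  have hb' : 0 < 1 - b := sub_pos.2 hb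
  have hK0 : 0 ≤ K := by positivity
  have hZ := H.sol.hasDerivAt_corrected H.energy (fun t => (H.s_mem t).1)
  have key := fun t (ht : T ≤ t) => abs_sub_le_of_abs_deriv_le ht hZ
    (fun t => ((H.sol.1 t).const_mul (-K))) (fun t ht' _ => ?_)
  · refine ⟨|(v T + Real.sin (u T) * Real.cos (u T) * w T) / Real.sqrt (s T)| + K + (1 + C),
      fun t ht => ?_⟩
    have h1 := key t ht
    have h2 := H.abs_virial_function_le t
    have hst := H.s_mem t
    have hr : 0 < Real.sqrt (s t) := Real.sqrt_pos.2 hst.1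
    have hr1 : Real.sqrt (s t) ≤ 1 := Real.sqrt_le_one.2 hst.2.le
    have h3 : K * (s t - s T) ≤ K * 1 :=
      mul_le_mul_of_nonneg_left (by linarith [(H.s_mem T).1]) hK0
    have h4 : |v t + Real.sin (u t) * Real.cos (u t) * w t| ≤
        |(v t + Real.sin (u t) * Real.cos (u t) * w t) / Real.sqrt (s t)| := by
      rw [abs_div, abs_of_pos hr, le_div_iff₀ hr]
      exact mul_le_of_le_one_right (abs_nonneg _) hr1
    have h5 := abs_sub_abs_le_abs_sub
      ((v t + Real.sin (u t) * Real.cos (u t) * w t) / Real.sqrt (s t))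
      ((v T + Real.sin (u T) * Real.cos (u T) * w T) / Real.sqrt (s T))
    have h6 : |v t| ≤ |v t + Real.sin (u t) * Real.cos (u t) * w t| +
        |Real.sin (u t) * Real.cos (u t) * w t| := by
      have := abs_sub (v t + Real.sin (u t) * Real.cos (u t) * w t)
        (Real.sin (u t) * Real.cos (u t) * w t)
      rwa [add_sub_cancel_right] at this
    linarith
  · have ht₀ := ht'.le
    have hst := H.s_mem t
    have hr : 0 < Real.sqrt (s t) := Real.sqrt_pos.2 hst.1
    have hx : 0 ≤ 1 - s t := sub_nonneg.2 hst.2.le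
    have hkin := H.kinetic_le t
    have h1 := abs_virial_remainder_le (v := v t) (w := w t) (x := 1 - s t)
      (A := Real.cos (u t) ^ 2 * (v t ^ 2 - 2 * h * s t)) (Real.sin_sq_add_cos_sq (u t))
      (sqrt_one_add_cos_sq (u t)) (Real.sqrt_nonneg _) hx (H.potential (u t)).2.2
    have hA : |Real.cos (u t) ^ 2 * (v t ^ 2 - 2 * h * s t)| ≤ C + 2 * h := by
      have h4 : s t * Real.cos (u t) ^ 2 ≤ 1 * 1 :=
        mul_le_mul hst.2.le (Real.cos_sq_le_one _) (sq_nonneg _) one_pos.le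
      have h5 : 0 ≤ s t * Real.cos (u t) ^ 2 := mul_nonneg hst.1.le (sq_nonneg _)
      rw [abs_le]
      constructor <;> nlinarith [sq_nonneg (w t), sq_nonneg (Real.cos (u t) * v t)]
    have h2 : 2 * w t ^ 2 + |Real.cos (u t) ^ 2 * (v t ^ 2 - 2 * h * s t)|
        + |Real.cos (u t) * v t * w t| + M * (1 - s t) ≤ 2 * C + (C + 2 * h) + C + M := by
      have := H.abs_mul_mul_le t
      nlinarith [sq_nonneg (Real.cos (u t) * v t)]
    have h3 := H.cos_sq_le_mul_deriv hb ht₀ (hsb t ht₀)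
    rw [abs_div, abs_of_pos hr, div_eq_mul_one_div]
    calc _ ≤ (Real.cos (u t) ^ 2 * (2 * C + (C + 2 * h) + C + M)) * (1 / Real.sqrt s₀) :=
          mul_le_mul (h1.trans (mul_le_mul_of_nonneg_left h2 (sq_nonneg _))) (H.inv_sqrt_le ht₀)
            (by positivity) (by positivity)
      _ ≤ (1 / (v₀ * s₀) * (1 / (1 - b)) * (v t * s t * (1 - s t) * Real.cos (u t) ^ 2) *
            (2 * C + (C + 2 * h) + C + M)) * (1 / Real.sqrt s₀) := by gcongr
      _ = _ := by rw [hK]; ring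

/-- The solution approaches the infinity manifold. -/
lemma tendsto_s (H : IsEscapeTail m3 h M v₀ s₀ T s v u w) : Tendsto s atTop (𝓝 1) := by
  refine (tendsto_or_exists_lt_of_monotoneOn H.s_mono
    (fun t _ => (H.s_mem t).2.le)).resolve_right ?_
  rintro ⟨b, hb, hsb⟩
  obtain ⟨V, hV⟩ := H.exists_abs_v_le hb hsb
  have hM := H.M_pos
  have hh := H.h_pos
  have hvs : 0 < v₀ * s₀ := mul_pos H.v₀_pos H.s₀_pos
  have hb' : 0 < 1 - b := sub_pos.2 hb
  set C := 2 * M + 2 * h with hC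
  set L := 2 * (V ^ 2 + 2 * h) + 2 * C + C + M with hL
  have hL0 : 0 ≤ L := by positivity
  set K := L * (1 / (v₀ * s₀) * (1 / (1 - b))) with hK
  have hK0 : 0 ≤ K := by positivity
  have hder := fun t => (H.sol.hasDerivAt_sin_mul_cos_mul t).sub ((H.sol.1 t).const_mul K)
  have key := fun t (ht : T ≤ t) => (convex_Ici T).image_sub_le_mul_sub_of_deriv_le
    (f := (fun t => Real.sin (u t) * Real.cos (u t) * w t) - fun t => K * s t)
    (fun t _ => (hder t).continuousAt.continuousWithinAt)
    (fun t _ => (hder t).differentiableAt.differentiableWithinAt) (C := -((1 - b) / 2))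
    (fun t ht' => ?_) T Set.self_mem_Ici t ht ht
  · set t := T + 2 / (1 - b) * (2 * (1 + C) + K + 1) with ht
    have htT : T ≤ t := by
      rw [ht]
      have : 0 ≤ 2 / (1 - b) * (2 * (1 + C) + K + 1) := by positivity
      linarith
    have h1 := key t htT
    have h2 : -((1 - b) / 2) * (t - T) = -(2 * (1 + C) + K + 1) := by
      rw [ht]
      field_simp
      ring
    have h3 := abs_le.1 (H.abs_virial_function_le t)
    have h4 := abs_le.1 (H.abs_virial_function_le T)
    have h5 : K * (s t - s T) ≤ K * 1 :=
      mul_le_mul_of_nonneg_left (by linarith [(H.s_mem T).1, (H.s_mem t).2]) hK0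
    rw [h2] at h1
    simp only [Pi.sub_apply] at h1
    linarith [h3.1, h4.2]
  · rw [interior_Ici] at ht'
    have ht₀ : T ≤ t := le_of_lt ht'
    rw [(hder t).deriv]
    have hst := H.s_mem t
    have hx : 0 ≤ 1 - s t := sub_nonneg.2 hst.2.le
    have hkin := H.kinetic_le t
    have h1 := virial_le (v := v t) (w := w t) (x := 1 - s t)
      (A := Real.cos (u t) ^ 2 * (v t ^ 2 - 2 * h * s t)) (Real.sin_sq_add_cos_sq (u t))
      (sqrt_one_add_cos_sq (u t)) (Real.sqrt_nonneg _) hst.1.le hst.2.le hx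
      (H.potential (u t)).2.2
    have hA : |Real.cos (u t) ^ 2 * (v t ^ 2 - 2 * h * s t)| ≤
        Real.cos (u t) ^ 2 * (V ^ 2 + 2 * h) := by
      rw [abs_mul, abs_of_nonneg (sq_nonneg _)]
      refine mul_le_mul_of_nonneg_left ?_ (sq_nonneg _)
      have h4 : v t ^ 2 ≤ V ^ 2 := sq_le_sq' (abs_le.1 (hV t ht₀)).1 (abs_le.1 (hV t ht₀)).2
      have h5 : h * s t ≤ h * 1 := mul_le_mul_of_nonneg_left hst.2.le hh.le
      have h6 : 0 ≤ h * s t := mul_nonneg hh.le hst.1.le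
      rw [abs_le]
      constructor <;> nlinarith [sq_nonneg (v t)]
    have h2 : 2 * w t ^ 2 + |Real.cos (u t) * v t * w t| + M * (1 - s t) ≤ 2 * C + C + M := by
      have := H.abs_mul_mul_le t
      nlinarith [sq_nonneg (Real.cos (u t) * v t)]
    have h2' := mul_le_mul_of_nonneg_left h2 (sq_nonneg (Real.cos (u t)))
    have hen := H.energy.sq_add_eq t
    have hW : (1 - b) * (1 / 2) ≤ (1 - s t) * Wpot m3 (u t) :=
      mul_le_mul (by linarith [hsb t ht₀]) (H.potential (u t)).1 (by norm_num) hx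
    have hA' := le_abs_self (Real.cos (u t) ^ 2 * (v t ^ 2 - 2 * h * s t))
    have h3 := H.cos_sq_le_mul_deriv hb ht₀ (hsb t ht₀)
    have h9 := mul_le_mul_of_nonneg_left h3 hL0
    rw [← mul_assoc, ← hK] at h9
    refine (sub_le_sub_right h1 _).trans ?_
    rw [hL] at h9
    linarith [abs_nonneg (Real.cos (u t) ^ 2 * (v t ^ 2 - 2 * h * s t))]

lemma tendsto_potential_term (H : IsEscapeTail m3 h M v₀ s₀ T s v u w) :
    Tendsto (fun t => 2 * (1 - s t) * Wpot m3 (u t)) atTop (𝓝 0) := by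
  have h1 : Tendsto (fun t => 2 * (M * (1 - s t))) atTop (𝓝 0) := by
    have := ((H.tendsto_s.const_sub 1).const_mul M).const_mul 2
    simpa using this
  refine squeeze_zero (fun t => ?_) (fun t => ?_) h1
  · linarith [H.potential_term_nonneg t]
  · linarith [H.potential_term_le t]

/-- Slow escape: if `v` stays below `√(2h)` it converges to `√(2h)`. -/
lemma tendsto_v_of_lt (H : IsEscapeTail m3 h M v₀ s₀ T s v u w)
    (hv : ∀ t, T ≤ t → v t < Real.sqrt (2 * h)) :
    Tendsto v atTop (𝓝 (Real.sqrt (2 * h))) := by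
  have hsq : Real.sqrt (2 * h) ^ 2 = 2 * h := Real.sq_sqrt (by linarith [H.h_pos])
  have hder := H.sol.hasDerivAt_v H.energy
  have hvpos : ∀ t, T ≤ t → 0 < v t := fun t ht => H.v₀_pos.trans_le (H.v_ge t ht)
  have hsc : ∀ t, 0 ≤ s t * Real.cos (u t) ^ 2 := fun t =>
    mul_nonneg (H.s_mem t).1.le (sq_nonneg _)
  have hmono : MonotoneOn v (Set.Ici T) := by
    refine monotoneOn_of_deriv_nonneg (convex_Ici _) H.sol.continuous.2.1.continuousOn
      (fun t _ => (hder t).differentiableAt.differentiableWithinAt) fun t ht => ?_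
    rw [interior_Ici] at ht
    have ht₀ : T ≤ t := le_of_lt ht
    rw [(hder t).deriv]
    have h1 : v t ^ 2 ≤ 2 * h := by
      rw [← hsq]
      exact pow_le_pow_left₀ (hvpos t ht₀).le (hv t ht₀).le 2
    nlinarith [mul_nonneg (hsc t) (sub_nonneg.2 h1), sq_nonneg (w t)]
  refine (tendsto_or_exists_lt_of_monotoneOn hmono fun t ht => (hv t ht).le).resolve_right ?_
  rintro ⟨b, hb, hvb⟩
  have hb0 : 0 < b := (hvpos T le_rfl).trans_le (hvb T le_rfl)
  have hbh : 0 < 2 * h - b ^ 2 := by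
    rw [← hsq, sub_pos]
    exact pow_lt_pow_left₀ hb hb0.le two_ne_zero
  set ε := (2 * h - b ^ 2) / (2 * b) with hε
  have hε0 : 0 < ε := by positivity
  have hεb : ε * b = (2 * h - b ^ 2) / 2 := by
    rw [hε]
    field_simp
  have hlog : ∀ t, HasDerivAt (fun t => ε * Real.log (1 - s t))
      (-(ε * (v t * s t * Real.cos (u t) ^ 2))) t := fun t => by
    have hx : 1 - s t ≠ 0 := (sub_pos.2 (H.s_mem t).2).ne'
    refine ((((H.sol.1 t).const_sub 1).log hx).const_mul ε).congr_deriv ?_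
    field_simp
  have hbound : ∀ t, T ≤ t → ε * Real.log (1 - s T) - b ≤ ε * Real.log (1 - s t) := by
    intro t ht
    have h1 := abs_sub_le_of_abs_deriv_le ht hlog (fun t => (hder t).neg) (fun t ht' _ => ?_)
    · simp only [Pi.neg_apply] at h1
      linarith [(abs_le.1 h1).1, hvb t ht, hvpos T le_rfl]
    · have ht₀ := ht'.le
      have h2 := hvb t ht₀
      have h3 := hvpos t ht₀
      have h4 : v t ^ 2 ≤ b ^ 2 := pow_le_pow_left₀ h3.le h2 2
      have h5 : ε * v t ≤ ε * b := mul_le_mul_of_nonneg_left h2 hε0.le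
      have h6 : ε * v t ≤ 1 / 2 * (2 * h - v t ^ 2) := by linarith
      have h7 := mul_le_mul_of_nonneg_left h6 (hsc t)
      rw [abs_neg, abs_of_nonneg (mul_nonneg hε0.le (by
        rw [mul_assoc]
        exact mul_nonneg h3.le (hsc t)))]
      linarith [sq_nonneg (w t)]
  have hx0 : Tendsto (fun t => 1 - s t) atTop (𝓝[>] 0) := by
    refine tendsto_nhdsWithin_iff.2 ⟨?_, Eventually.of_forall fun t => sub_pos.2 (H.s_mem t).2⟩
    simpa using H.tendsto_s.const_sub 1
  have hbot : Tendsto (fun t => ε * Real.log (1 - s t)) atTop atBot :=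
    (Real.tendsto_log_nhdsGT_zero.comp hx0).const_mul_atBot hε0
  obtain ⟨t, ht, htT⟩ := ((hbot.eventually_lt_atBot (ε * Real.log (1 - s T) - b)).and
    (eventually_ge_atTop T)).exists
  exact absurd (hbound t htT) (not_le.2 ht)

/-- Fast escape: if `v` is eventually at least `√(2h)` it converges. -/
lemma exists_tendsto_v_of_le (H : IsEscapeTail m3 h M v₀ s₀ T s v u w)
    (hv : ∀ t, T ≤ t → Real.sqrt (2 * h) ≤ v t) :
    Tendsto w atTop (𝓝 0) ∧ ∃ l, Tendsto v atTop (𝓝 l) := by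
  have hM := H.M_pos
  have hh := H.h_pos
  have hsq : Real.sqrt (2 * h) ^ 2 = 2 * h := Real.sq_sqrt (by linarith)
  have hA : ∀ t, T ≤ t → 0 ≤ Real.cos (u t) ^ 2 * (v t ^ 2 - 2 * h * s t) := fun t ht => by
    refine mul_nonneg (sq_nonneg _) ?_
    have h1 := pow_le_pow_left₀ (Real.sqrt_nonneg _) (hv t ht) 2
    have h2 : h * s t ≤ h * 1 := mul_le_mul_of_nonneg_left (H.s_mem t).2.le hh.le
    linarith
  have hw : Tendsto w atTop (𝓝 0) := by
    refine tendsto_zero_of_tendsto_sq_zero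
      (squeeze_zero' (Eventually.of_forall fun t => sq_nonneg _) ?_ H.tendsto_potential_term)
    filter_upwards [eventually_ge_atTop T] with t ht
    linarith [H.energy.sq_add_eq t, hA t ht]
  refine ⟨hw, ?_⟩
  have hvs : 0 < v₀ * s₀ := mul_pos H.v₀_pos H.s₀_pos
  set C := 2 * M + 2 * h with hC
  set L := 7 * M + Real.sqrt (2 * M * C) with hL
  have hL0 : 0 ≤ L := by positivity
  set K := L * (1 / (v₀ * s₀)) * (1 / Real.sqrt s₀) with hK
  have hK0 : 0 ≤ K := by positivity
  have hroot : ∀ t, HasDerivAt (fun t => 2 * K * Real.sqrt (1 - s t))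
      (-(K * (v t * s t * Real.cos (u t) ^ 2) * Real.sqrt (1 - s t))) t := fun t => by
    have hx : 0 < 1 - s t := sub_pos.2 (H.s_mem t).2
    have hr : 0 < Real.sqrt (1 - s t) := Real.sqrt_pos.2 hx
    have hrx : Real.sqrt (1 - s t) ^ 2 = 1 - s t := Real.sq_sqrt hx.le
    refine ((((H.sol.1 t).const_sub 1).sqrt hx.ne').const_mul (2 * K)).congr_deriv ?_
    rw [mul_div_assoc', div_eq_iff (by positivity)]
    linear_combination (2 * K * (v t * s t * Real.cos (u t) ^ 2)) * hrx
  have hroot0 : Tendsto (fun t => 2 * K * Real.sqrt (1 - s t)) atTop (𝓝 0) := by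
    have := (H.tendsto_s.const_sub 1).sqrt.const_mul (2 * K)
    simpa using this
  have hconv : ∃ l, Tendsto (fun t => (v t + Real.sin (u t) * Real.cos (u t) * w t) /
      Real.sqrt (s t)) atTop (𝓝 l) := by
    refine exists_tendsto_of_abs_deriv_le (T := T)
      (H.sol.hasDerivAt_corrected H.energy (fun t => (H.s_mem t).1)) hroot (fun t ht => ?_) hroot0
    have hst := H.s_mem t
    have hr : 0 < Real.sqrt (s t) := Real.sqrt_pos.2 hst.1
    have hx : 0 ≤ 1 - s t := sub_nonneg.2 hst.2.le
    have h1 := abs_virial_remainder_le (v := v t) (w := w t) (x := 1 - s t)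
      (A := Real.cos (u t) ^ 2 * (v t ^ 2 - 2 * h * s t)) (Real.sin_sq_add_cos_sq (u t))
      (sqrt_one_add_cos_sq (u t)) (Real.sqrt_nonneg _) hx (H.potential (u t)).2.2
    set R := Real.sqrt (1 - s t) with hR
    have hR0 : 0 ≤ R := Real.sqrt_nonneg _
    have hR2 : R ^ 2 = 1 - s t := Real.sq_sqrt hx
    have hR1 : R ≤ 1 := Real.sqrt_le_one.2 (by linarith [hst.1])
    have hxR : 1 - s t ≤ R := by nlinarith
    have hAt := hA t ht
    have hen := H.energy.sq_add_eq t
    have hpot := H.potential_term_le t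
    have hMx : M * (1 - s t) ≤ M * R := mul_le_mul_of_nonneg_left hxR hM.le
    have hcross : |Real.cos (u t) * v t * w t| ≤ Real.sqrt (2 * M * C) * R := by
      refine abs_le_of_sq_le_sq ?_ (by positivity)
      rw [mul_pow (Real.cos (u t) * v t), mul_pow (Real.sqrt _), Real.sq_sqrt (by positivity), hR2]
      have h2 : w t ^ 2 ≤ 2 * M * (1 - s t) := by linarith
      have h3 : (Real.cos (u t) * v t) ^ 2 ≤ C := by linarith [H.kinetic_le t, sq_nonneg (w t)]
      calc _ ≤ C * (2 * M * (1 - s t)) := mul_le_mul h3 h2 (sq_nonneg _) (by positivity)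
        _ = _ := by ring
    have h2 : 2 * w t ^ 2 + |Real.cos (u t) ^ 2 * (v t ^ 2 - 2 * h * s t)|
        + |Real.cos (u t) * v t * w t| + M * (1 - s t) ≤ L * R := by
      rw [abs_of_nonneg hAt, hL]
      linarith [sq_nonneg (w t)]
    rw [abs_div, abs_of_pos hr, div_eq_mul_one_div, neg_neg]
    calc _ ≤ (Real.cos (u t) ^ 2 * (L * R)) * (1 / Real.sqrt s₀) :=
          mul_le_mul (h1.trans (mul_le_mul_of_nonneg_left h2 (sq_nonneg _))) (H.inv_sqrt_le ht)
            (by positivity) (by positivity)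
      _ ≤ (1 / (v₀ * s₀) * (v t * s t * Real.cos (u t) ^ 2) * (L * R)) *
            (1 / Real.sqrt s₀) := by
          have := H.cos_sq_le ht
          gcongr
      _ = _ := by rw [hK]; ring
  obtain ⟨l, hl⟩ := hconv
  refine ⟨l * Real.sqrt 1 - 0, ?_⟩
  have hvir : Tendsto (fun t => Real.sin (u t) * Real.cos (u t) * w t) atTop (𝓝 0) := by
    refine squeeze_zero_norm (fun t => ?_) (tendsto_zero_iff_norm_tendsto_zero.1 hw)
    rw [norm_mul, norm_mul]
    exact mul_le_of_le_one_left (norm_nonneg _) (mul_le_one₀ (Real.abs_sin_le_one _)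
      (norm_nonneg _) (Real.abs_cos_le_one _))
  refine ((hl.mul H.tendsto_s.sqrt).sub hvir).congr fun t => ?_
  rw [div_mul_cancel₀ _ (Real.sqrt_pos.2 (H.s_mem t).1).ne', add_sub_cancel_right]

lemma of_le (H : IsEscapeTail m3 h M v₀ s₀ T s v u w) {T' : ℝ} (hT : T ≤ T') :
    IsEscapeTail m3 h M v₀ s₀ T' s v u w where
  __ := H
  v_ge t ht := H.v_ge t (hT.trans ht)
  s_ge t ht := H.s_ge t (hT.trans ht)
  s_mono := H.s_mono.mono (Set.Ici_subset_Ici.2 hT)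

lemma tendsto_w_and_v (H : IsEscapeTail m3 h M v₀ s₀ T s v u w) :
    Tendsto w atTop (𝓝 0) ∧ ∃ l, Real.sqrt (2 * h) ≤ l ∧ Tendsto v atTop (𝓝 l) := by
  have hsq : Real.sqrt (2 * h) ^ 2 = 2 * h := Real.sq_sqrt (by linarith [H.h_pos])
  by_cases hv : ∀ t, T ≤ t → v t < Real.sqrt (2 * h)
  · have hlim := H.tendsto_v_of_lt hv
    refine ⟨?_, _, le_rfl, hlim⟩
    have h1 : Tendsto (fun t => 2 * (1 - s t) * Wpot m3 (u t) + |v t ^ 2 - 2 * h * s t|)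
        atTop (𝓝 0) := by
      have := H.tendsto_potential_term.add
        (((hlim.pow 2).sub (H.tendsto_s.const_mul (2 * h))).abs)
      simpa only [hsq, mul_one, sub_self, abs_zero, add_zero] using this
    refine tendsto_zero_of_tendsto_sq_zero (squeeze_zero (fun t => sq_nonneg _) (fun t => ?_) h1)
    have h2 : Real.cos (u t) ^ 2 * |v t ^ 2 - 2 * h * s t| ≤ |v t ^ 2 - 2 * h * s t| :=
      mul_le_of_le_one_left (abs_nonneg _) (Real.cos_sq_le_one _)
    have h3 := mul_le_mul_of_nonneg_left (neg_abs_le (v t ^ 2 - 2 * h * s t))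
      (sq_nonneg (Real.cos (u t)))
    linarith [H.energy.sq_add_eq t]
  · push Not at hv
    obtain ⟨T', hT, hvT⟩ := hv
    have hge : ∀ t, T' ≤ t → Real.sqrt (2 * h) ≤ v t := fun t ht =>
      H.sol.le_v_of_le H.energy (fun t => (H.s_mem t).1) hsq.le hvT ht
    obtain ⟨hw, l, hl⟩ := (H.of_le hT).exists_tendsto_v_of_le hge
    exact ⟨hw, l, ge_of_tendsto hl ((eventually_ge_atTop T').mono hge), hl⟩

/-- Away from the binary collisions `w` is damped, up to a forcing by `1 - s`. -/
lemma w_mul_deriv_le (H : IsEscapeTail m3 h M v₀ s₀ T s v u w) {δ t : ℝ} (hδ : 0 < δ)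
    (ht : T ≤ t) (hcos : δ ≤ Real.cos (u t) ^ 2)
    (hw : (M + (2 * M + 1) / δ) * |w t| ≤ v₀ * δ / 4) :
    w t * (-(1 / 2) * (1 + s t) * v t * w t * Real.cos (u t) ^ 2
      + 1 / 2 * Real.sqrt (1 + Real.cos (u t) ^ 2) * (1 - s t) * deriv (Wpot m3) (u t)
      + 1 / 2 * (v t ^ 2 - 2 * h * s t) * Real.sqrt (1 + Real.cos (u t) ^ 2)
          * Real.sin (u t) * Real.cos (u t)) ≤
      -(v₀ * δ / 4) * w t ^ 2 + (M + (2 * M + 1) / δ) * |w t| * (1 - s t) := by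
  have hM := H.M_pos
  have hst := H.s_mem t
  have hx : 0 ≤ 1 - s t := sub_nonneg.2 hst.2.le
  have hv := H.v_ge t ht
  have hv₀ := H.v₀_pos
  set c := Real.cos (u t) with hc
  set q := Real.sqrt (1 + c ^ 2) with hq
  have hc2 : c ^ 2 ≤ 1 := Real.cos_sq_le_one _
  have hc1 : |c| ≤ 1 := Real.abs_cos_le_one _
  have hq0 : 0 ≤ q := Real.sqrt_nonneg _
  have hq2 : q ≤ 2 := by
    rw [hq, Real.sqrt_le_left (by norm_num)]
    linarith
  have hS : |Real.sin (u t)| ≤ 1 := Real.abs_sin_le_one _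
  have hdamp : v₀ * δ / 2 * w t ^ 2 ≤ 1 / 2 * (1 + s t) * v t * c ^ 2 * w t ^ 2 := by
    refine mul_le_mul_of_nonneg_right ?_ (sq_nonneg _)
    have h1 : v₀ * δ ≤ v t * c ^ 2 := mul_le_mul hv hcos hδ.le (hv₀.le.trans hv)
    have h2 : 0 ≤ s t * (v t * c ^ 2) :=
      mul_nonneg hst.1.le (mul_nonneg (hv₀.le.trans hv) (sq_nonneg _))
    linarith
  have hforce : w t * (1 / 2 * q * (1 - s t) * deriv (Wpot m3) (u t)) ≤
      M * |w t| * (1 - s t) := by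
    refine (le_abs_self _).trans ?_
    have hD : |deriv (Wpot m3) (u t)| ≤ M :=
      (H.potential (u t)).2.2.trans (mul_le_of_le_one_right hM.le hc1)
    rw [abs_mul, abs_mul, abs_mul, abs_of_nonneg hx, abs_of_nonneg (by linarith : 0 ≤ 1 / 2 * q)]
    have h1 : 1 / 2 * q * (1 - s t) ≤ 1 * (1 - s t) :=
      mul_le_mul_of_nonneg_right (by linarith) hx
    calc _ ≤ |w t| * (1 * (1 - s t) * M) := mul_le_mul_of_nonneg_left
          (mul_le_mul h1 hD (abs_nonneg _) (by linarith)) (abs_nonneg _)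
      _ = _ := by ring
  have hquad : |v t ^ 2 - 2 * h * s t| ≤ (2 * (M * (1 - s t)) + w t ^ 2) / δ := by
    rw [le_div_iff₀ hδ]
    have h1 : c ^ 2 * |v t ^ 2 - 2 * h * s t| ≤ 2 * (M * (1 - s t)) + w t ^ 2 := by
      rw [← abs_of_nonneg (sq_nonneg c), ← abs_mul, abs_le]
      have := H.energy.sq_add_eq t
      have h2 := H.potential_term_le t
      have h3 := H.potential_term_nonneg t
      constructor <;> linarith [sq_nonneg (w t), mul_nonneg hM.le hx]
    have h2 := mul_le_mul_of_nonneg_right hcos (abs_nonneg (v t ^ 2 - 2 * h * s t))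
    linarith
  have hcentral : w t * (1 / 2 * (v t ^ 2 - 2 * h * s t) * q * Real.sin (u t) * c) ≤
      |w t| * ((2 * (M * (1 - s t)) + w t ^ 2) / δ) := by
    refine (le_abs_self _).trans ?_
    rw [abs_mul]
    refine mul_le_mul_of_nonneg_left ?_ (abs_nonneg _)
    rw [show 1 / 2 * (v t ^ 2 - 2 * h * s t) * q * Real.sin (u t) * c =
      (1 / 2 * q) * Real.sin (u t) * c * (v t ^ 2 - 2 * h * s t) by ring, abs_mul, abs_mul,
      abs_mul, abs_of_nonneg (by linarith : 0 ≤ 1 / 2 * q)]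
    refine (mul_le_of_le_one_left (abs_nonneg _) ?_).trans hquad
    exact mul_le_one₀ (mul_le_one₀ (by linarith) (abs_nonneg _) hS) (abs_nonneg _) hc1
  have hsplit : |w t| * ((2 * (M * (1 - s t)) + w t ^ 2) / δ) =
      2 * M / δ * |w t| * (1 - s t) + 1 / δ * |w t| * w t ^ 2 := by ring
  have hcoef : (M + (2 * M + 1) / δ) * |w t| =
      M * |w t| + 2 * M / δ * |w t| + 1 / δ * |w t| := by ring
  have hnn1 : 0 ≤ M * |w t| := by positivity
  have hnn2 : 0 ≤ 2 * M / δ * |w t| := by positivity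
  have hnn3 : 0 ≤ 1 / δ * |w t| * (1 - s t) := by positivity
  have hcube : 1 / δ * |w t| * w t ^ 2 ≤ v₀ * δ / 4 * w t ^ 2 :=
    mul_le_mul_of_nonneg_right (by linarith) (sq_nonneg _)
  rw [hcoef]
  linarith

/-- Away from the binary collisions the motion of `u` is controlled by an exponentially
decaying quantity. -/
lemma exists_potential_for_u (H : IsEscapeTail m3 h M v₀ s₀ T s v u w)
    (hw : Tendsto w atTop (𝓝 0)) {δ : ℝ} (hδ : 0 < δ) :
    ∃ (Φ Φ' : ℝ → ℝ) (T' : ℝ), (∀ t, HasDerivAt Φ (Φ' t) t) ∧ (∀ t, 0 ≤ Φ t) ∧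
      Tendsto Φ atTop (𝓝 0) ∧ ∀ t, T' ≤ t → δ ≤ Real.cos (u t) ^ 2 →
        |1 / 2 * Real.sqrt (1 + Real.cos (u t) ^ 2) * w t| ≤ -Φ' t := by
  have hM := H.M_pos
  have hv₀ := H.v₀_pos
  have hs₀ := H.s₀_pos
  set K := M + (2 * M + 1) / δ with hK
  have hK0 : 0 < K := by positivity
  set a := v₀ * δ / 4 with ha
  have ha0 : 0 < a := by positivity
  set d := v₀ * s₀ * δ with hd
  have hd0 : 0 < d := by positivity
  set b := K ^ 2 / (a * d) with hb
  have hb0 : 0 < b := by positivity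
  set κ := min a d / 2 with hκ
  have hκ0 : 0 < κ := half_pos (lt_min ha0 hd0)
  have hκa : κ ≤ a / 2 := by linarith [min_le_left a d]
  have hκd : κ ≤ d / 2 := by linarith [min_le_right a d]
  have hGpos : ∀ t, 0 < w t ^ 2 + b * (1 - s t) ^ 2 := fun t => by
    have : 0 < 1 - s t := sub_pos.2 (H.s_mem t).2
    positivity
  have hG := fun t => ((H.sol.2.2.2 t).fun_pow 2).fun_add
    ((((H.sol.1 t).const_sub 1).fun_pow 2).const_mul b)
  have hΦ := fun t => ((hG t).sqrt (hGpos t).ne').div_const κ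
  have hsmall : ∀ᶠ t in atTop, K * |w t| ≤ a := by
    have h1 : Tendsto (fun t => K * |w t|) atTop (𝓝 0) := by simpa using hw.abs.const_mul K
    exact h1.eventually_le_const ha0
  obtain ⟨T', hT'⟩ := eventually_atTop.1 hsmall
  refine ⟨_, _, max T T', hΦ, fun t => by positivity, ?_, fun t ht hcos => ?_⟩
  · have h1 := ((hw.pow 2).add (((H.tendsto_s.const_sub 1).pow 2).const_mul b)).sqrt.div_const κ
    simpa using h1
  · have htT := (le_max_left T T').trans ht
    have hx : 0 < 1 - s t := sub_pos.2 (H.s_mem t).2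
    have h1 := H.w_mul_deriv_le hδ htT hcos (hT' t ((le_max_right T T').trans ht))
    rw [← hK, ← ha] at h1
    set w' := -(1 / 2) * (1 + s t) * v t * w t * Real.cos (u t) ^ 2
      + 1 / 2 * Real.sqrt (1 + Real.cos (u t) ^ 2) * (1 - s t) * deriv (Wpot m3) (u t)
      + 1 / 2 * (v t ^ 2 - 2 * h * s t) * Real.sqrt (1 + Real.cos (u t) ^ 2)
          * Real.sin (u t) * Real.cos (u t) with hw'
    set F := Real.sqrt (w t ^ 2 + b * (1 - s t) ^ 2) with hF
    have hF0 : 0 < F := Real.sqrt_pos.2 (hGpos t)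
    have hF2 : F ^ 2 = w t ^ 2 + b * (1 - s t) ^ 2 := Real.sq_sqrt (hGpos t).le
    have hwF : |w t| ≤ F := Real.abs_le_sqrt (by
      have : 0 ≤ b * (1 - s t) ^ 2 := by positivity
      linarith)
    have hdecay : d * (1 - s t) ^ 2 ≤ v t * s t * Real.cos (u t) ^ 2 * (1 - s t) ^ 2 := by
      refine mul_le_mul_of_nonneg_right ?_ (sq_nonneg _)
      exact mul_le_mul (mul_le_mul (H.v_ge t htT) (H.s_ge t htT) hs₀.le
        (hv₀.le.trans (H.v_ge t htT))) hcos hδ.le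
        (mul_nonneg (hv₀.le.trans (H.v_ge t htT)) (H.s_mem t).1.le)
    have hyoung : K * |w t| * (1 - s t) ≤ a / 2 * w t ^ 2 + b * d / 2 * (1 - s t) ^ 2 := by
      have h2 : b * d = K ^ 2 / a := by
        rw [hb]
        field_simp
      have h3 : 0 ≤ (a * |w t| - K * (1 - s t)) ^ 2 / (2 * a) := by positivity
      have h4 : (a * |w t| - K * (1 - s t)) ^ 2 / (2 * a) =
          a / 2 * |w t| ^ 2 + K ^ 2 / a / 2 * (1 - s t) ^ 2 - K * |w t| * (1 - s t) := by
        field_simp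
        ring
      rw [sq_abs] at h4
      rw [h2]
      linarith
    have hdiss : w t * w' - b * (v t * s t * Real.cos (u t) ^ 2 * (1 - s t) ^ 2) ≤
        -(κ * F ^ 2) := by
      have h2 := mul_le_mul_of_nonneg_left hdecay hb0.le
      have h3 := mul_le_mul_of_nonneg_right hκa (sq_nonneg (w t))
      have h4 := mul_le_mul_of_nonneg_right hκd (by positivity : 0 ≤ b * (1 - s t) ^ 2)
      rw [hF2]
      linarith
    have hq : Real.sqrt (1 + Real.cos (u t) ^ 2) ≤ 2 := by
      rw [Real.sqrt_le_left (by norm_num)]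
      linarith [Real.cos_sq_le_one (u t)]
    have hu : |1 / 2 * Real.sqrt (1 + Real.cos (u t) ^ 2) * w t| ≤ |w t| := by
      rw [abs_mul, abs_of_nonneg (by positivity)]
      exact mul_le_of_le_one_left (abs_nonneg _) (by linarith)
    refine (hu.trans hwF).trans ?_
    rw [← neg_div, ← neg_div, div_div, le_div_iff₀ (by positivity)]
    push_cast
    linarith

/-- The configuration converges once `w → 0`. -/
lemma exists_tendsto_u (H : IsEscapeTail m3 h M v₀ s₀ T s v u w)
    (hw : Tendsto w atTop (𝓝 0)) : ∃ l, Tendsto u atTop (𝓝 l) := by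
  have huc : Continuous u := H.sol.continuous.2.2.1
  by_cases hc : Tendsto (fun t => Real.cos (u t) ^ 2) atTop (𝓝 0)
  · exact exists_tendsto_of_tendsto_cos huc (tendsto_zero_of_tendsto_sq_zero hc)
  have hfreq : ∃ δ > 0, ∀ N, ∃ t, N ≤ t ∧ 2 * δ ≤ Real.cos (u t) ^ 2 := by
    rw [Metric.tendsto_atTop] at hc
    push Not at hc
    obtain ⟨ε, hε, hc⟩ := hc
    refine ⟨ε / 2, half_pos hε, fun N => ?_⟩
    obtain ⟨t, ht, htε⟩ := hc N
    rw [Real.dist_eq, sub_zero, abs_of_nonneg (sq_nonneg _)] at htε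
    exact ⟨t, ht, by linarith⟩
  obtain ⟨δ, hδ, hfreq⟩ := hfreq
  obtain ⟨Φ, Φ', T', hΦ, hΦ0, hΦlim, hu⟩ := H.exists_potential_for_u hw hδ
  obtain ⟨N, hN⟩ := eventually_atTop.1
    ((hΦlim.eventually_lt_const (half_pos hδ)).and (eventually_ge_atTop T'))
  obtain ⟨t₀, ht₀, hcos₀⟩ := hfreq N
  have hstay : ∀ t, t₀ ≤ t → δ ≤ Real.cos (u t) ^ 2 := by
    intro t₁ ht₁
    by_contra! hlt
    have hcont : Continuous fun t => Real.cos (u t) ^ 2 := by fun_prop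
    obtain ⟨t₂, ⟨ht₂, hcos₂⟩, hmin⟩ :=
      (isCompact_Icc.inter_right (isClosed_le hcont continuous_const) :
        IsCompact (Set.Icc t₀ t₁ ∩ {t | Real.cos (u t) ^ 2 ≤ δ})).exists_isLeast
        ⟨t₁, Set.right_mem_Icc.2 ht₁, hlt.le⟩
    have h1 := abs_sub_le_of_abs_deriv_le ht₂.1 H.sol.2.2.1 hΦ fun t ht ht' => by
      refine hu t ((hN t₀ ht₀).2.trans ht.le) ?_
      by_contra! hlt'
      exact absurd (hmin ⟨⟨ht.le, ht'.le.trans ht₂.2⟩, hlt'.le⟩) (not_le.2 ht')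
    have h2 := (hN t₀ ht₀).1
    have h3 := hΦ0 t₂
    have h4 : |Real.cos (u t₂) - Real.cos (u t₀)| ≤ |u t₂ - u t₀| :=
      Real.abs_cos_sub_cos_le _ _
    have h5 : |Real.cos (u t₂) + Real.cos (u t₀)| ≤ 2 :=
      (abs_add_le _ _).trans (by linarith [Real.abs_cos_le_one (u t₂), Real.abs_cos_le_one (u t₀)])
    have h6 : |Real.cos (u t₂) ^ 2 - Real.cos (u t₀) ^ 2| ≤ |u t₂ - u t₀| * 2 := by
      rw [sq_sub_sq, abs_mul, mul_comm]
      exact mul_le_mul h4 h5 (abs_nonneg _) (abs_nonneg _)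
    have h7 := (abs_le.1 h6).1
    have h8 : Real.cos (u t₂) ^ 2 ≤ δ := hcos₂
    linarith
  exact exists_tendsto_of_abs_deriv_le (T := t₀) H.sol.2.2.1 hΦ
    (fun t ht => hu t ((hN t₀ ht₀).2.trans ht) (hstay t ht)) hΦlim

end IsEscapeTail

end Orbit

/-- every solution with `h > 0`, `0 < s < 1` and no forward triple collision
converges as `τ → +∞` to an equilibrium `(1, v₊, u₊, 0)` on the infinity manifold
`{s = 1}` with `v₊ ≥ √(2h)`; moreover `cos u₊ ≠ 0` forces `v₊ = √(2h)`, and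
`v₊ > √(2h)` forces `cos u₊ = 0`. -/
theorem stmt14 (m3 h : ℝ) (hm3 : 0 < m3) (hh : 0 < h) (s v u w : ℝ → ℝ)
    (hsol : IsSolution m3 h s v u w) (hE : SatisfiesEnergy m3 h s v u w)
    (hs : ∀ τ : ℝ, 0 < s τ ∧ s τ < 1) (hv : ∃ τs : ℝ, 0 ≤ v τs) :
    Tendsto s atTop (nhds 1) ∧ Tendsto w atTop (nhds 0) ∧
    ∃ uplus vplus : ℝ,
      Tendsto u atTop (nhds uplus) ∧ Tendsto v atTop (nhds vplus) ∧
      Real.sqrt (2 * h) ≤ vplus ∧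
      (Real.cos uplus ≠ 0 → vplus = Real.sqrt (2 * h)) ∧
      (Real.sqrt (2 * h) < vplus → Real.cos uplus = 0) := by
  obtain ⟨M, v₀, s₀, T, H⟩ := exists_isEscapeTail hm3 hh hsol hE hs hv
  obtain ⟨hw, vplus, hle, hvlim⟩ := H.tendsto_w_and_v
  obtain ⟨uplus, hulim⟩ := H.exists_tendsto_u hw
  have hcos : Tendsto (fun t => Real.cos (u t)) atTop (𝓝 (Real.cos uplus)) :=
    (Real.continuous_cos.tendsto _).comp hulim
  have hlim : Real.cos uplus ^ 2 * (vplus ^ 2 - 2 * h) = 0 := by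
    have h1 := (hw.pow 2).add
      ((hcos.pow 2).mul ((hvlim.pow 2).sub (H.tendsto_s.const_mul (2 * h))))
    have h2 := tendsto_nhds_unique (h1.congr fun t => hE.sq_add_eq t) H.tendsto_potential_term
    linarith
  have hv0 : 0 ≤ vplus := (Real.sqrt_nonneg _).trans hle
  have hcase : Real.cos uplus ≠ 0 → vplus = Real.sqrt (2 * h) := fun hne => by
    have h1 := (mul_eq_zero.1 hlim).resolve_left (pow_ne_zero 2 hne)
    rw [← sub_eq_zero.1 h1, Real.sqrt_sq hv0]
  exact ⟨H.tendsto_s, hw, uplus, vplus, hulim, hvlim, hle, hcase, fun hlt => by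
    by_contra hne
    exact hlt.ne' (hcase hne)⟩
end

section
/- Let h > 0 and let (s,v,u,w) be a solution of the regularized blown-up system satisfying the energy relation with s(tau) = 1 for all tau (a solution on the infinity manifold, where the energy relation becomes (1/2)*(v^2*cos(u)^2 + w^2) = h*cos(u)^2). Then for all tau: v'(tau) = w(tau)^2 >= 0, so v is nondecreasing; the function Theta(tau) = theta(u(tau)) is differentiable with Theta'(tau) = w(tau)*cos(u(tau)); and the identity (2*h - v(tau)^2) * Theta'(tau)^2 = v'(tau)^2 holds. -/
open Real Filter Topology MeasureTheory

/-- The shape angle as a function of the regularized shape variable. -/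
noncomputable def shapeAngle (x : ℝ) : ℝ :=
  Real.arcsin (Real.sin x * Real.sqrt (1 + Real.cos x ^ 2))

theorem sin_mul_sqrt_sq (x : ℝ) :
    (Real.sin x * Real.sqrt (1 + Real.cos x ^ 2)) ^ 2 = 1 - (Real.cos x ^ 2) ^ 2 := by
  rw [mul_pow, Real.sq_sqrt (by positivity), Real.sin_sq]
  ring

theorem cos_shapeAngle (x : ℝ) : Real.cos (shapeAngle x) = Real.cos x ^ 2 := by
  rw [shapeAngle, Real.cos_arcsin, sin_mul_sqrt_sq, sub_sub_cancel, Real.sqrt_sq (sq_nonneg _)]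

theorem shapeAngle_neg (x : ℝ) : shapeAngle (-x) = -shapeAngle x := by
  simp [shapeAngle, Real.arcsin_neg]

theorem abs_shapeAngle_sub_pi_div_two_le {x : ℝ} (hx : 0 ≤ Real.sin x) :
    |shapeAngle x - π / 2| ≤ π / 2 * Real.cos x ^ 2 := by
  have h0 : 0 ≤ shapeAngle x := Real.arcsin_nonneg.2 (by positivity)
  have h1 : shapeAngle x ≤ π / 2 := Real.arcsin_le_pi_div_two _
  have h2 := Real.mul_le_sin (x := π / 2 - shapeAngle x) (by linarith) (by linarith)
  rw [Real.sin_pi_div_two_sub, cos_shapeAngle] at h2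
  rw [abs_sub_comm, abs_of_nonneg (by linarith)]
  calc π / 2 - shapeAngle x = π / 2 * (2 / π * (π / 2 - shapeAngle x)) := by
        field_simp
    _ ≤ π / 2 * Real.cos x ^ 2 := by gcongr

theorem hasDerivAt_shapeAngle_of_sin_eq_one {x : ℝ} (hx : Real.sin x = 1) :
    HasDerivAt shapeAngle 0 x := by
  have hc : Real.cos x = 0 := by
    have := Real.sin_sq_add_cos_sq x
    rw [hx] at this
    exact pow_eq_zero_iff two_ne_zero |>.1 (by linarith)
  have hθ : shapeAngle x = π / 2 := by
    simp [shapeAngle, hx, hc]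
  have hbig : (fun y => shapeAngle y - π / 2) =O[𝓝 x] fun y => Real.cos y ^ 2 := by
    refine Asymptotics.IsBigO.of_bound (π / 2) ?_
    have hpos : ∀ᶠ y in 𝓝 x, 0 < Real.sin y :=
      Real.continuous_sin.continuousAt.eventually (lt_mem_nhds (by rw [hx]; exact one_pos))
    filter_upwards [hpos] with y hy
    simpa using abs_shapeAngle_sub_pi_div_two_le hy.le
  have hO : Real.cos =O[𝓝 x] fun y => y - x := by
    simpa [hc] using (Real.hasDerivAt_cos x).isBigO_sub
  have ho : Real.cos =o[𝓝 x] fun _ => (1 : ℝ) := by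
    rw [Asymptotics.isLittleO_one_iff, ← hc]
    exact Real.continuous_cos.tendsto x
  rw [hasDerivAt_iff_isLittleO]
  simpa [hθ] using hbig.trans_isLittleO (by simpa [sq] using hO.mul_isLittleO ho)

theorem hasDerivAt_shapeAngle (x : ℝ) :
    HasDerivAt shapeAngle (2 * Real.cos x / Real.sqrt (1 + Real.cos x ^ 2)) x := by
  have hsc := Real.sin_sq_add_cos_sq x
  by_cases hc : Real.cos x = 0
  · simp only [hc, mul_zero, zero_div]
    rcases eq_or_eq_neg_of_sq_eq_sq (Real.sin x) 1 (by simpa [hc] using hsc) with hs | hs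
    · exact hasDerivAt_shapeAngle_of_sin_eq_one hs
    · have h := ((hasDerivAt_shapeAngle_of_sin_eq_one (x := -x) (by simp [hs])).comp x
        (hasDerivAt_neg x)).fun_neg
      simpa [shapeAngle_neg] using h
  · have hq : 0 < 1 + Real.cos x ^ 2 := by positivity
    have hS : Real.sqrt (1 + Real.cos x ^ 2) ≠ 0 := (Real.sqrt_pos.2 hq).ne'
    have hne : (Real.sin x * Real.sqrt (1 + Real.cos x ^ 2)) ^ 2 ≠ 1 := by
      rw [sin_mul_sqrt_sq]
      have : 0 < (Real.cos x ^ 2) ^ 2 := by positivity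
      linarith
    have hin : HasDerivAt (fun y => Real.sin y * Real.sqrt (1 + Real.cos y ^ 2))
        (Real.cos x * Real.sqrt (1 + Real.cos x ^ 2) + Real.sin x *
          (2 * Real.cos x * -Real.sin x / (2 * Real.sqrt (1 + Real.cos x ^ 2)))) x := by
      have hcos : HasDerivAt (fun y => 1 + Real.cos y ^ 2) (2 * Real.cos x * -Real.sin x) x := by
        simpa using ((Real.hasDerivAt_cos x).fun_pow 2).const_add 1
      exact (Real.hasDerivAt_sin x).mul (hcos.sqrt hq.ne')
    refine ((Real.hasDerivAt_arcsin (fun h => hne (by rw [h]; norm_num))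
      (fun h => hne (by rw [h]; norm_num))).comp x hin).congr_deriv ?_
    rw [sin_mul_sqrt_sq, sub_sub_cancel, Real.sqrt_sq (sq_nonneg _)]
    have hS2 := Real.sq_sqrt hq.le
    field_simp
    rw [hS2]
    linear_combination -hsc

/-- for a solution on the infinity manifold (`s ≡ 1`) satisfying the energy
relation with `h > 0`: `v' = w² ≥ 0` so `v` is nondecreasing; the shape angle
`Θ(τ) = θ(u(τ))` with `θ(x) = arcsin(sin x·√(1+cos²x))` is differentiable with
`Θ' = w·cos u`; and `(2h - v²)·Θ'² = (v')²`. -/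
theorem stmt15 (m3 h : ℝ) (hm3 : 0 < m3) (hh : 0 < h) (s v u w : ℝ → ℝ)
    (hsol : IsSolution m3 h s v u w) (hE : SatisfiesEnergy m3 h s v u w)
    (hs1 : ∀ τ : ℝ, s τ = 1) :
    (∀ τ : ℝ, deriv v τ = w τ ^ 2 ∧ 0 ≤ deriv v τ) ∧
    Monotone v ∧
    (∀ τ : ℝ, HasDerivAt
      (fun σ => Real.arcsin (Real.sin (u σ) * Real.sqrt (1 + Real.cos (u σ) ^ 2)))
      (w τ * Real.cos (u τ)) τ) ∧
    (∀ τ : ℝ, (2 * h - v τ ^ 2) * (w τ * Real.cos (u τ)) ^ 2 = deriv v τ ^ 2) := by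
  obtain ⟨-, hv, hu, -⟩ := hsol
  have hv' (τ : ℝ) : HasDerivAt v (w τ ^ 2) τ := by simpa [hs1] using hv τ
  have hderiv (τ : ℝ) : deriv v τ = w τ ^ 2 := (hv' τ).deriv
  have hnonneg (τ : ℝ) : 0 ≤ deriv v τ := hderiv τ ▸ sq_nonneg _
  refine ⟨fun τ => ⟨hderiv τ, hnonneg τ⟩,
    monotone_of_deriv_nonneg (fun τ => (hv' τ).differentiableAt) hnonneg, fun τ => ?_, fun τ => ?_⟩
  · refine ((hasDerivAt_shapeAngle (u τ)).comp τ (hu τ)).congr_deriv ?_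
    have hS : Real.sqrt (1 + Real.cos (u τ) ^ 2) ≠ 0 := (Real.sqrt_pos.2 (by positivity)).ne'
    field_simp
  · have hEτ := hE τ
    simp only [energyFn, hs1] at hEτ
    rw [hderiv]
    linear_combination (-2 * w τ ^ 2) * hEτ
end

section
/- Let mu1, lambda1, lambda2, k, delta be positive real numbers with lambda1 <= lambda2 and lambda2 - lambda1 < mu1. Then for every epsilon > 0 there exists eta > 0 with the following property. Whenever T > 0 and x, y, z : [0,T] -> R are differentiable functions satisfying, for all t in [0,T]: 0 <= x(t) <= delta, 0 < y(t) <= delta, x'(t) <= -mu1*x(t), lambda1*y(t) <= y'(t) <= lambda2*y(t), and |z'(t)| <= k*x(t)*y(t), together with the boundary conditions x(0) = delta, y(T) = delta, and y(0) < eta, then: (1/lambda2)*log(delta/y(0)) <= T <= (1/lambda1)*log(delta/y(0)), x(T) < epsilon, and |z(T) - z(0)| < epsilon. -/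
open Real Filter Topology

/-- Grönwall's inequality in monotonicity form. -/
theorem antitoneOn_mul_exp_of_deriv_le {u u' : ℝ → ℝ} {a b c : ℝ}
    (hu : ∀ t ∈ Set.Icc a b, HasDerivWithinAt u (u' t) (Set.Icc a b) t)
    (h : ∀ t ∈ Set.Icc a b, u' t ≤ c * u t) :
    AntitoneOn (fun t => u t * exp (-c * t)) (Set.Icc a b) := by
  have hd : ∀ t ∈ Set.Icc a b, HasDerivWithinAt (fun t => u t * exp (-c * t))
      (u' t * exp (-c * t) + u t * (exp (-c * t) * -c)) (Set.Icc a b) t := fun t ht =>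
    (hu t ht).mul (((hasDerivAt_id t).const_mul (-c)).exp.hasDerivWithinAt.congr_deriv (by simp))
  refine antitoneOn_of_hasDerivWithinAt_nonpos (convex_Icc a b)
    (fun t ht => (hd t ht).continuousWithinAt)
    (fun t ht => (hd t (interior_subset ht)).mono interior_subset) fun t ht => ?_
  nlinarith [h t (interior_subset ht), exp_pos (-c * t)]

theorem monotoneOn_mul_exp_of_le_deriv {u u' : ℝ → ℝ} {a b c : ℝ}
    (hu : ∀ t ∈ Set.Icc a b, HasDerivWithinAt u (u' t) (Set.Icc a b) t)
    (h : ∀ t ∈ Set.Icc a b, c * u t ≤ u' t) :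
    MonotoneOn (fun t => u t * exp (-c * t)) (Set.Icc a b) := by
  have key := antitoneOn_mul_exp_of_deriv_le (u := fun t => -u t) (u' := fun t => -u' t) (c := c)
    (fun t ht => (hu t ht).neg) (fun t ht => by linarith [h t ht])
  intro s hs t ht hst
  have := key hs ht hst
  simp only at this ⊢
  linarith

theorem exists_forall_ge_mul_exp_lt {m : ℝ} (hm : 0 < m) (A B : ℝ) {ε : ℝ} (hε : 0 < ε) :
    ∃ T₀ : ℝ, ∀ T ≥ T₀, A * exp (-m * T) < ε ∧ B * (T * exp (-m * T)) < ε := by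
  have h0 : Tendsto (fun T : ℝ => A * exp (-m * T)) atTop (𝓝 0) := by
    simpa using (tendsto_rpow_mul_exp_neg_mul_atTop_nhds_zero 0 m hm).const_mul A
  have h1 : Tendsto (fun T : ℝ => B * (T * exp (-m * T))) atTop (𝓝 0) := by
    simpa using (tendsto_rpow_mul_exp_neg_mul_atTop_nhds_zero 1 m hm).const_mul B
  exact eventually_atTop.1 ((h0.eventually_lt_const hε).and (h1.eventually_lt_const hε))

/-- quantitative passage lemma near a normally hyperbolic line of
equilibria.  Given rates `0 < μ₁`, `0 < λ₁ ≤ λ₂` with `λ₂ - λ₁ < μ₁`, a coupling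
constant `k > 0`, and a box size `δ > 0`, for every `ε > 0` there is `η > 0` such that
any trio of differentiable functions `x, y, z` on `[0,T]` satisfying the differential
inequalities `x' ≤ -μ₁ x`, `λ₁ y ≤ y' ≤ λ₂ y`, `|z'| ≤ k x y` inside the box
`0 ≤ x ≤ δ`, `0 < y ≤ δ`, with `x(0) = δ`, `y(T) = δ`, `y(0) < η`, satisfies the travel
time bounds `(1/λ₂)log(δ/y(0)) ≤ T ≤ (1/λ₁)log(δ/y(0))` and exits with `x(T) < ε` and
`|z(T) - z(0)| < ε`. -/
theorem stmt17 (mu1 lam1 lam2 k δ : ℝ) (hmu1 : 0 < mu1) (hlam1 : 0 < lam1)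
    (hlam2 : 0 < lam2) (hk : 0 < k) (hδ : 0 < δ) (hle : lam1 ≤ lam2)
    (hgap : lam2 - lam1 < mu1) :
    ∀ ε > 0, ∃ η > 0, ∀ T > 0, ∀ x y z xd yd zd : ℝ → ℝ,
      (∀ t ∈ Set.Icc (0 : ℝ) T, HasDerivWithinAt x (xd t) (Set.Icc (0 : ℝ) T) t) →
      (∀ t ∈ Set.Icc (0 : ℝ) T, HasDerivWithinAt y (yd t) (Set.Icc (0 : ℝ) T) t) →
      (∀ t ∈ Set.Icc (0 : ℝ) T, HasDerivWithinAt z (zd t) (Set.Icc (0 : ℝ) T) t) →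
      (∀ t ∈ Set.Icc (0 : ℝ) T, 0 ≤ x t ∧ x t ≤ δ) →
      (∀ t ∈ Set.Icc (0 : ℝ) T, 0 < y t ∧ y t ≤ δ) →
      (∀ t ∈ Set.Icc (0 : ℝ) T, xd t ≤ -mu1 * x t) →
      (∀ t ∈ Set.Icc (0 : ℝ) T, lam1 * y t ≤ yd t ∧ yd t ≤ lam2 * y t) →
      (∀ t ∈ Set.Icc (0 : ℝ) T, |zd t| ≤ k * x t * y t) →
      x 0 = δ → y T = δ → y 0 < η →
      (1 / lam2) * Real.log (δ / y 0) ≤ T ∧ T ≤ (1 / lam1) * Real.log (δ / y 0) ∧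
      x T < ε ∧ |z T - z 0| < ε := by
  intro ε hε
  obtain ⟨m, hm, hm1, hm2⟩ : ∃ m > 0, m ≤ mu1 ∧ m ≤ lam1 :=
    ⟨min mu1 lam1, lt_min hmu1 hlam1, min_le_left _ _, min_le_right _ _⟩
  obtain ⟨T₀, hT₀⟩ := exists_forall_ge_mul_exp_lt hm δ (k * δ ^ 2) hε
  refine ⟨δ * exp (-lam2 * T₀), by positivity, ?_⟩
  intro T hT x y z xd yd zd hx hy hz hxb hyb hxd hyd hzd hx0 hyT hy0
  have h0 : (0 : ℝ) ∈ Set.Icc 0 T := ⟨le_rfl, hT.le⟩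
  have h1 : T ∈ Set.Icc 0 T := ⟨hT.le, le_rfl⟩
  have hy0p := (hyb 0 h0).1
  have hanti := antitoneOn_mul_exp_of_deriv_le hy fun t ht => (hyd t ht).2
  have hmono := monotoneOn_mul_exp_of_le_deriv hy fun t ht => (hyd t ht).1
  have hxle : ∀ t ∈ Set.Icc 0 T, x t ≤ δ * exp (-mu1 * t) := by
    intro t ht
    have := antitoneOn_mul_exp_of_deriv_le hx hxd h0 ht ht.1
    simp only [hx0, neg_neg, mul_zero, exp_zero, mul_one] at this
    rwa [neg_mul, exp_neg, ← div_eq_mul_inv, le_div_iff₀ (exp_pos _)]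
  have hyle : ∀ t ∈ Set.Icc 0 T, y t ≤ δ * exp (-lam1 * (T - t)) := by
    intro t ht
    have := hmono ht h1 ht.2
    simp only [hyT] at this
    rw [show -lam1 * (T - t) = -lam1 * T - -lam1 * t by ring, exp_sub, ← mul_div_assoc,
      le_div_iff₀ (exp_pos _)]
    exact this
  have hlog_le : log (δ / y 0) ≤ lam2 * T := by
    have := hanti h0 h1 hT.le
    simp only [hyT, mul_zero, exp_zero, mul_one] at this
    rw [neg_mul, exp_neg, ← div_eq_mul_inv, div_le_iff₀ (exp_pos _)] at this
    rw [log_le_iff_le_exp (by positivity), div_le_iff₀ hy0p]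
    linarith
  have hle_log : lam1 * T ≤ log (δ / y 0) := by
    have := hyle 0 h0
    rw [sub_zero, neg_mul, exp_neg, ← div_eq_mul_inv, le_div_iff₀ (exp_pos _)] at this
    rw [le_log_iff_exp_le (by positivity), le_div_iff₀ hy0p]
    linarith
  have hTT : T₀ ≤ T := by
    have : lam2 * T₀ < log (δ / y 0) := by
      rw [neg_mul, exp_neg, ← div_eq_mul_inv, lt_div_iff₀ (exp_pos _)] at hy0
      rw [lt_log_iff_exp_lt (by positivity), lt_div_iff₀ hy0p]
      linarith
    exact le_of_mul_le_mul_left (this.le.trans hlog_le) hlam2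
  obtain ⟨hA, hB⟩ := hT₀ T hTT
  refine ⟨?_, ?_, ?_, ?_⟩
  · rw [one_div, inv_mul_le_iff₀ hlam2]
    exact hlog_le
  · rw [one_div, le_inv_mul_iff₀ hlam1]
    exact hle_log
  · refine ((hxle T h1).trans ?_).trans_lt hA
    gcongr
  · have hbound : ∀ t ∈ Set.Icc 0 T, ‖zd t‖ ≤ k * δ ^ 2 * exp (-m * T) := by
      intro t ht
      have hexp : exp (-mu1 * t) * exp (-lam1 * (T - t)) ≤ exp (-m * T) := by
        rw [← exp_add, exp_le_exp]
        nlinarith [mul_le_mul_of_nonneg_right hm1 ht.1,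
          mul_le_mul_of_nonneg_right hm2 (sub_nonneg.2 ht.2)]
      calc ‖zd t‖ ≤ k * x t * y t := hzd t ht
        _ ≤ k * (δ * exp (-mu1 * t)) * (δ * exp (-lam1 * (T - t))) := by
          have := (hyb t ht).1.le
          gcongr
          exacts [hxle t ht, hyle t ht]
        _ = k * δ ^ 2 * (exp (-mu1 * t) * exp (-lam1 * (T - t))) := by ring
        _ ≤ k * δ ^ 2 * exp (-m * T) := by gcongr
    have := (convex_Icc 0 T).norm_image_sub_le_of_norm_hasDerivWithin_le hz hbound h0 h1
    rw [Real.norm_eq_abs, Real.norm_eq_abs, sub_zero, abs_of_pos hT] at this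
    linarith
end

section
/- Let h = 1/2, let l_plus = arccos( ((2+m3)/(2*(1+2*m3)))^(1/4) ), which lies in (0, pi/2) and is the Lagrange central configuration shape, and set v_plus = sqrt(2*W(l_plus))/cos(l_plus). Then v_plus > 1, and there exists a solution (s,v,u,w) of the regularized blown-up system satisfying the energy relation with u(tau) = l_plus and w(tau) = 0 for all tau (the Lagrange homothetic orbit), such that: v is strictly decreasing with v(tau) -> v_plus as tau -> -infinity and v(tau) -> 1 as tau -> +infinity; s is strictly increasing with s(tau) -> 0 as tau -> -infinity and s(tau) -> 1 as tau -> +infinity; and s(tau) = (v_plus^2 - v(tau)^2)/(v_plus^2 - 1) for all tau. In particular this solution is a heteroclinic orbit from the triple collision restpoint L_plus = (0, v_plus, l_plus, 0) to the restpoint (1, 1, l_plus, 0) on the infinity manifold. -/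
open Real Filter Topology MeasureTheory

/-- The inverse of a differentiable function on an interval `(a, b)` that decreases from `+∞`
to `-∞` with negative derivative. -/
theorem exists_strictAnti_inverse {a b : ℝ} (hab : a < b) (f f' : ℝ → ℝ)
    (hf : ∀ y ∈ Set.Ioo a b, HasDerivAt f (f' y) y) (hf' : ∀ y ∈ Set.Ioo a b, f' y < 0)
    (ha : Tendsto f (𝓝[>] a) atTop) (hb : Tendsto f (𝓝[<] b) atBot) :
    ∃ v : ℝ → ℝ, (∀ t, v t ∈ Set.Ioo a b) ∧ (∀ t, HasDerivAt v (f' (v t))⁻¹ t) ∧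
      StrictAnti v ∧ Tendsto v atBot (𝓝 b) ∧ Tendsto v atTop (𝓝 a) := by
  have hcont : ContinuousOn f (Set.Ioo a b) := fun y hy =>
    (hf y hy).continuousAt.continuousWithinAt
  have hanti : StrictAntiOn f (Set.Ioo a b) := by
    refine strictAntiOn_of_deriv_neg (convex_Ioo a b) hcont fun y hy => ?_
    rw [interior_Ioo] at hy
    rw [(hf y hy).deriv]
    exact hf' y hy
  have hsurj : ∀ t : ℝ, ∃ y ∈ Set.Ioo a b, f y = t := by
    intro t
    obtain ⟨y₁, h₁, h₁'⟩ := ((ha.eventually_ge_atTop t).and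
      (Ioo_mem_nhdsGT hab)).exists
    obtain ⟨y₂, h₂, h₂'⟩ := ((hb.eventually_le_atBot t).and
      (Ioo_mem_nhdsLT hab)).exists
    exact isPreconnected_Ioo.intermediate_value h₂' h₁' hcont ⟨h₂, h₁⟩
  choose v hv hfv using hsurj
  have lt_iff : ∀ t, ∀ y ∈ Set.Ioo a b, (y < v t ↔ t < f y) := fun t y hy => by
    rw [← hanti.lt_iff_gt (hv t) hy, hfv]
  have gt_iff : ∀ t, ∀ y ∈ Set.Ioo a b, (v t < y ↔ f y < t) := fun t y hy => by
    rw [← hanti.lt_iff_gt hy (hv t), hfv]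
  have eventually_gt : ∀ (l : Filter ℝ) (y : ℝ), y < b →
      (∀ z ∈ Set.Ioo a b, z = y → ∀ᶠ t in l, t < f z) → ∀ᶠ t in l, y < v t := by
    intro l y hy h
    rcases le_or_gt y a with hya | hya
    · exact Eventually.of_forall fun t => hya.trans_lt (hv t).1
    · filter_upwards [h y ⟨hya, hy⟩ rfl] with t ht using (lt_iff t y ⟨hya, hy⟩).2 ht
  have eventually_lt : ∀ (l : Filter ℝ) (y : ℝ), a < y →
      (∀ z ∈ Set.Ioo a b, z = y → ∀ᶠ t in l, f z < t) → ∀ᶠ t in l, v t < y := by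
    intro l y hy h
    rcases le_or_gt b y with hyb | hyb
    · exact Eventually.of_forall fun t => (hv t).2.trans_le hyb
    · filter_upwards [h y ⟨hy, hyb⟩ rfl] with t ht using (gt_iff t y ⟨hy, hyb⟩).2 ht
  have hvcont : ∀ t, ContinuousAt v t := by
    intro t
    refine tendsto_order.2 ⟨fun y hy => ?_, fun y hy => ?_⟩
    · refine eventually_gt _ y (hy.trans (hv t).2) fun z hz hzy => ?_
      subst hzy
      exact eventually_lt_nhds ((lt_iff t z hz).1 hy)
    · refine eventually_lt _ y ((hv t).1.trans hy) fun z hz hzy => ?_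
      subst hzy
      exact eventually_gt_nhds ((gt_iff t z hz).1 hy)
  refine ⟨v, hv, fun t => ?_, fun t₁ t₂ h => ?_, ?_, ?_⟩
  · exact HasDerivAt.of_local_left_inverse (hvcont t) (hf _ (hv t)) (hf' _ (hv t)).ne
      (Eventually.of_forall hfv)
  · rw [gt_iff _ _ (hv t₁), hfv]
    exact h
  · refine tendsto_order.2 ⟨fun y hy => ?_, fun y hy => ?_⟩
    · exact eventually_gt _ y hy fun z _ _ => eventually_lt_atBot (f z)
    · exact Eventually.of_forall fun t => (hv t).2.trans hy
  · refine tendsto_order.2 ⟨fun y hy => ?_, fun y hy => ?_⟩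
    · exact Eventually.of_forall fun t => hy.trans (hv t).1
    · exact eventually_lt _ y hy fun z _ _ => eventually_gt_atTop (f z)

/-- The scalar equation `v' = -C (v² - 1) (p² - v²) / (2 (p² - 1))` has a global solution
decreasing from `p` to `1`. -/
theorem exists_heteroclinic_solution {p C : ℝ} (hp : 1 < p) (hC : 0 < C) :
    ∃ v : ℝ → ℝ, (∀ t, v t ∈ Set.Ioo 1 p) ∧
      (∀ t, HasDerivAt v
        (-(C * (v t ^ 2 - 1) * (p ^ 2 - v t ^ 2) / (2 * (p ^ 2 - 1)))) t) ∧
      StrictAnti v ∧ Tendsto v atBot (𝓝 p) ∧ Tendsto v atTop (𝓝 1) := by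
  have hp0 : 0 < p := one_pos.trans hp
  have hpp : 0 < p ^ 2 - 1 := by nlinarith
  have hlogp : ∀ y : ℝ, 0 < y → ContinuousAt (fun y => log (p + y)) y := fun y hy => by
    refine ContinuousAt.log (by fun_prop) (by positivity)
  have hlog1 : ∀ y : ℝ, 0 < y → ContinuousAt (fun y => log (y + 1)) y := fun y hy => by
    refine ContinuousAt.log (by fun_prop) (by positivity)
  refine Exists.imp ?_ (exists_strictAnti_inverse hp
    (fun y => C⁻¹ * ((log (y + 1) - p⁻¹ * log (p + y)) + (p⁻¹ * log (p - y) - log (y - 1))))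
    (fun y => -(2 * (p ^ 2 - 1) / (C * (y ^ 2 - 1) * (p ^ 2 - y ^ 2)))) ?_ ?_ ?_ ?_)
  · rintro v ⟨hv, hd, h⟩
    refine ⟨hv, fun t => ?_, h⟩
    convert hd t using 1
    rw [← neg_inv, inv_div]
  · rintro y ⟨hy1, hyp⟩
    have e1 : y + 1 ≠ 0 := by linarith
    have e2 : p + y ≠ 0 := by linarith
    have e3 : p - y ≠ 0 := by linarith
    have e4 : y - 1 ≠ 0 := by linarith
    have d1 := ((hasDerivAt_id y).add_const (1 : ℝ)).log e1
    have d2 := ((hasDerivAt_id y).const_add p).log e2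
    have d3 := ((hasDerivAt_id y).const_sub p).log e3
    have d4 := ((hasDerivAt_id y).sub_const (1 : ℝ)).log e4
    refine (((d1.sub (d2.const_mul p⁻¹)).add ((d3.const_mul p⁻¹).sub d4)).const_mul
      C⁻¹).congr_deriv ?_
    have e5 : y ^ 2 - 1 ≠ 0 := by nlinarith
    have e6 : p ^ 2 - y ^ 2 ≠ 0 := by nlinarith
    simp only [id]
    rw [show y ^ 2 - 1 = (y - 1) * (y + 1) by ring,
      show p ^ 2 - y ^ 2 = (p - y) * (p + y) by ring]
    field_simp
    ring
  · rintro y ⟨hy1, hyp⟩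
    have e5 : 0 < y ^ 2 - 1 := by nlinarith
    have e6 : 0 < p ^ 2 - y ^ 2 := by nlinarith
    rw [neg_lt_zero]
    positivity
  · refine Tendsto.const_mul_atTop (inv_pos.2 hC) ?_
    have hsub : Tendsto (fun y : ℝ => y - 1) (𝓝[>] 1) (𝓝[>] 0) := by
      refine tendsto_nhdsWithin_iff.2 ⟨?_, ?_⟩
      · have : ContinuousAt (fun y : ℝ => y - 1) 1 := by fun_prop
        simpa [ContinuousAt] using this.tendsto.mono_left nhdsWithin_le_nhds
      · filter_upwards [self_mem_nhdsWithin] with y hy using Set.mem_Ioi.2 (sub_pos.2 hy)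
    have hlim : Tendsto (fun y => log (y - 1)) (𝓝[>] 1) atBot :=
      tendsto_log_nhdsGT_zero.comp hsub
    have hc : ContinuousAt (fun y => (log (y + 1) - p⁻¹ * log (p + y)) + p⁻¹ * log (p - y)) 1 := by
      have h1 := hlog1 1 one_pos
      have h2 := hlogp 1 one_pos
      have h3 : ContinuousAt (fun y => log (p - y)) 1 :=
        ContinuousAt.log (by fun_prop) (by linarith)
      fun_prop
    refine ((hc.tendsto.mono_left nhdsWithin_le_nhds).add_atTop
      (tendsto_neg_atBot_atTop.comp hlim)).congr fun y => ?_
    simp only [Function.comp]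
    ring
  · refine Tendsto.const_mul_atBot (inv_pos.2 hC) ?_
    have hsub : Tendsto (fun y : ℝ => p - y) (𝓝[<] p) (𝓝[>] 0) := by
      refine tendsto_nhdsWithin_iff.2 ⟨?_, ?_⟩
      · have : ContinuousAt (fun y : ℝ => p - y) p := by fun_prop
        simpa [ContinuousAt] using this.tendsto.mono_left nhdsWithin_le_nhds
      · filter_upwards [self_mem_nhdsWithin] with y hy using Set.mem_Ioi.2 (sub_pos.2 hy)
    have hlim : Tendsto (fun y => log (p - y)) (𝓝[<] p) atBot :=
      tendsto_log_nhdsGT_zero.comp hsub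
    have hc : ContinuousAt (fun y => (log (y + 1) - p⁻¹ * log (p + y)) - log (y - 1)) p := by
      have h1 := hlog1 p hp0
      have h2 := hlogp p hp0
      have h3 : ContinuousAt (fun y => log (y - 1)) p :=
        ContinuousAt.log (by fun_prop) (by linarith)
      fun_prop
    refine ((hc.tendsto.mono_left nhdsWithin_le_nhds).add_atBot
      (hlim.const_mul_atBot (inv_pos.2 hp0))).congr fun y => ?_
    ring

/-- At the Lagrange shape the square root in the potential simplifies. -/
theorem sqrt_lagrange {m c : ℝ} (hm : 0 < m) (hc4 : c ^ 4 = (2 + m) / (2 * (1 + 2 * m))) :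
    √(c ^ 4 / 2 + (1 - c ^ 4) / (2 * m / (2 + m))) = √2 * c ^ 2 := by
  have : c ^ 4 / 2 + (1 - c ^ 4) / (2 * m / (2 + m)) = 2 * (c ^ 2) ^ 2 := by
    rw [← pow_mul, hc4]
    field_simp
    ring
  rw [this, sqrt_mul zero_le_two, sqrt_sq (sq_nonneg c)]

theorem Wpot_lagrange {m l : ℝ} (hm : 0 < m) (hc : 0 < cos l)
    (hc4 : cos l ^ 4 = (2 + m) / (2 * (1 + 2 * m))) : Wpot m l = (1 + 2 * m) / √2 := by
  rw [Wpot, sqrt_lagrange hm hc4]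
  field_simp

theorem hasDerivAt_Wpot_lagrange {m l : ℝ} (hm : 0 < m) (hc : 0 < cos l)
    (hc4 : cos l ^ 4 = (2 + m) / (2 * (1 + 2 * m))) :
    HasDerivAt (Wpot m) (-(2 * Wpot m l * sin l / cos l)) l := by
  have hs := sqrt_lagrange hm hc4
  have hpos : 0 < √2 * cos l ^ 2 := by positivity
  have hD : cos l ^ 4 / 2 + (1 - cos l ^ 4) / (2 * m / (2 + m)) ≠ 0 :=
    (sqrt_pos.1 (hs ▸ hpos)).ne'
  have hcos := hasDerivAt_cos l
  have d := ((((hcos.pow 2).const_mul (2 * m)).div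
    ((((hcos.pow 4).div_const 2).add
      (((hcos.pow 4).const_sub 1).div_const (2 * m / (2 + m)))).sqrt hD)
    (by simp only [Pi.add_apply, Pi.pow_apply]; rw [hs]; exact hpos.ne')).const_add (1 / √2))
  refine d.congr_deriv ?_
  simp only [Pi.add_apply, Pi.pow_apply]
  rw [hs, Wpot_lagrange hm hc hc4]
  have h2 : √2 ^ 2 = 2 := sq_sqrt zero_le_two
  field_simp
  rw [h2]
  ring

/-- the Lagrange homothetic orbit for energy `h = 1/2`.  With
`l₊ = arccos(((2+m3)/(2(1+2m3)))^{1/4}) ∈ (0, π/2)` and `v₊ = √(2W(l₊))/cos(l₊) > 1`,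
there is a solution with `u ≡ l₊`, `w ≡ 0`, `v` strictly decreasing from `v₊` (at
`τ → -∞`) to `1` (at `τ → +∞`), `s` strictly increasing from `0` to `1`, and
`s = (v₊² - v²)/(v₊² - 1)`; it is a heteroclinic orbit from the triple collision
restpoint `L₊ = (0, v₊, l₊, 0)` to the restpoint `(1, 1, l₊, 0)` at infinity. -/
theorem stmt18 (m3 : ℝ) (hm3 : 0 < m3) (lp vp : ℝ)
    (hlp : lp = Real.arccos (((2 + m3) / (2 * (1 + 2 * m3))) ^ ((1 : ℝ) / 4)))
    (hvp : vp = Real.sqrt (2 * Wpot m3 lp) / Real.cos lp) :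
    0 < lp ∧ lp < Real.pi / 2 ∧ 1 < vp ∧
    ∃ s v u w : ℝ → ℝ,
      IsSolution m3 (1 / 2) s v u w ∧ SatisfiesEnergy m3 (1 / 2) s v u w ∧
      (∀ τ : ℝ, u τ = lp ∧ w τ = 0) ∧
      StrictAnti v ∧ Tendsto v atBot (nhds vp) ∧ Tendsto v atTop (nhds 1) ∧
      StrictMono s ∧ Tendsto s atBot (nhds 0) ∧ Tendsto s atTop (nhds 1) ∧
      (∀ τ : ℝ, s τ = (vp ^ 2 - v τ ^ 2) / (vp ^ 2 - 1)) := by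
  set q : ℝ := (2 + m3) / (2 * (1 + 2 * m3)) with hq
  have hq0 : 0 < q := by positivity
  have hq1 : q < 1 := by
    rw [hq, div_lt_one (by positivity)]
    linarith
  have hr0 : 0 < q ^ ((1 : ℝ) / 4) := rpow_pos_of_pos hq0 _
  have hr1 : q ^ ((1 : ℝ) / 4) < 1 := rpow_lt_one hq0.le hq1 (by norm_num)
  have hcos : cos lp = q ^ ((1 : ℝ) / 4) := by
    rw [hlp, cos_arccos (by linarith) hr1.le]
  have hc4 : cos lp ^ 4 = q := by
    rw [hcos, ← rpow_natCast, ← rpow_mul hq0.le]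
    norm_num
  have hc0 : 0 < cos lp := hcos ▸ hr0
  have hc1 : cos lp < 1 := hcos ▸ hr1
  have hW := Wpot_lagrange hm3 hc0 hc4
  have hW1 : 1 / 2 < Wpot m3 lp := by
    have h2 : √2 < 2 := by
      rw [sqrt_lt' two_pos]
      norm_num
    rw [hW, div_lt_div_iff₀ two_pos (by positivity)]
    linarith
  have hvp2 : vp ^ 2 * cos lp ^ 2 = 2 * Wpot m3 lp := by
    rw [hvp, div_pow, sq_sqrt (by linarith)]
    field_simp
  have hvp1 : 1 < vp := by
    have h1 : 1 < √(2 * Wpot m3 lp) := by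
      rw [lt_sqrt zero_le_one]
      linarith
    rw [hvp, lt_div_iff₀ hc0]
    linarith
  have hP : 0 < vp ^ 2 - 1 := by nlinarith
  refine ⟨by rw [hlp]; exact arccos_pos.2 hr1, by rw [hlp]; exact arccos_lt_pi_div_two.2 hr0,
    hvp1, ?_⟩
  obtain ⟨v, hv, hd, hanti, hbot, htop⟩ :=
    exists_heteroclinic_solution hvp1 (C := cos lp ^ 2) (by positivity)
  have hWp : Wpot m3 lp = vp ^ 2 * cos lp ^ 2 / 2 := by linarith
  refine ⟨fun t => (vp ^ 2 - v t ^ 2) / (vp ^ 2 - 1), v, fun _ => lp, fun _ => 0,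
    ⟨fun t => ?_, fun t => ?_, fun t => ?_, fun t => ?_⟩, fun t => ?_, fun _ => ⟨rfl, rfl⟩,
    hanti, hbot, htop, fun t₁ t₂ h => ?_, ?_, ?_, fun _ => rfl⟩
  · refine ((((hd t).pow 2).const_sub (vp ^ 2)).div_const (vp ^ 2 - 1)).congr_deriv ?_
    field_simp
    ring
  · refine (hd t).congr_deriv ?_
    rw [hWp]
    field_simp
    ring
  · simpa using hasDerivAt_const t lp
  · refine (hasDerivAt_const t (0 : ℝ)).congr_deriv ?_
    rw [(hasDerivAt_Wpot_lagrange hm3 hc0 hc4).deriv, hWp]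
    field_simp
    ring
  · simp only [energyFn]
    rw [hWp]
    field_simp
    ring
  · have h1 := hanti h
    have h2 := (hv t₂).1
    exact div_lt_div_of_pos_right (by nlinarith) hP
  · have h := ((hbot.pow 2).const_sub (vp ^ 2)).div_const (vp ^ 2 - 1)
    rwa [sub_self, zero_div] at h
  · have h := ((htop.pow 2).const_sub (vp ^ 2)).div_const (vp ^ 2 - 1)
    rwa [one_pow, div_self hP.ne'] at h
end
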